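/- arXiv:1311.6360 — 11 statements merged into one kernel-verified Lean document; each statement's English description precedes it below -/
import Mathlib

section
/- Let p ∈ (0,1) and let f₀, f₁ ≥ 0 be real numbers with p f₁ + (1−p) f₀ > 0. Then √(p f₁ + (1−p) f₀) ≤ √(p f₁) + √((1−p) f₀) − √(p(1−p) f₀ f₁) / (√(p f₁) + √((1−p) f₀)), and this in turn is at most √(p f₁) + √((1−p) f₀) − (√(p(1−p)) / (√p + √(1−p))) · √(min{f₀, f₁}). -/
/-- Two successive upper bounds on the square root of a two-component mixture. -/
theorem sqrt_mixture_bounds (p f₀ f₁ : ℝ) (hp : p ∈ Set.Ioo (0 : ℝ) 1)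
    (hf₀ : 0 ≤ f₀) (hf₁ : 0 ≤ f₁) (hpos : 0 < p * f₁ + (1 - p) * f₀) :
    Real.sqrt (p * f₁ + (1 - p) * f₀)
      ≤ Real.sqrt (p * f₁) + Real.sqrt ((1 - p) * f₀)
          - Real.sqrt (p * (1 - p) * f₀ * f₁)
              / (Real.sqrt (p * f₁) + Real.sqrt ((1 - p) * f₀))
    ∧ Real.sqrt (p * f₁) + Real.sqrt ((1 - p) * f₀)
          - Real.sqrt (p * (1 - p) * f₀ * f₁)
              / (Real.sqrt (p * f₁) + Real.sqrt ((1 - p) * f₀))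
      ≤ Real.sqrt (p * f₁) + Real.sqrt ((1 - p) * f₀)
          - (Real.sqrt (p * (1 - p)) / (Real.sqrt p + Real.sqrt (1 - p)))
              * Real.sqrt (min f₀ f₁) := by
  obtain ⟨hp0, hp1⟩ := hp
  have hq : 0 < 1 - p := by linarith
  have ha : 0 < Real.sqrt p := Real.sqrt_pos.2 hp0
  have hb : 0 < Real.sqrt (1 - p) := Real.sqrt_pos.2 hq
  have ea : Real.sqrt p ^ 2 = p := Real.sq_sqrt hp0.le
  have eb : Real.sqrt (1 - p) ^ 2 = 1 - p := Real.sq_sqrt hq.le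
  have ex : Real.sqrt f₀ ^ 2 = f₀ := Real.sq_sqrt hf₀
  have ey : Real.sqrt f₁ ^ 2 = f₁ := Real.sq_sqrt hf₁
  have hx : 0 ≤ Real.sqrt f₀ := Real.sqrt_nonneg _
  have hy : 0 ≤ Real.sqrt f₁ := Real.sqrt_nonneg _
  have e3 : Real.sqrt (p * (1 - p) * f₀ * f₁)
      = Real.sqrt p * Real.sqrt (1 - p) * Real.sqrt f₀ * Real.sqrt f₁ := by
    rw [Real.sqrt_mul (by positivity), Real.sqrt_mul (by positivity), Real.sqrt_mul hp0.le]
  rw [e3, Real.sqrt_mul hp0.le f₁, Real.sqrt_mul hq.le f₀, Real.sqrt_mul hp0.le (1 - p)]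
  have em : Real.sqrt (min f₀ f₁) = min (Real.sqrt f₀) (Real.sqrt f₁) :=
    Real.sqrt_monotone.map_min
  rw [em]
  have e4 : p * f₁ + (1 - p) * f₀
      = (Real.sqrt p * Real.sqrt f₁) ^ 2 + (Real.sqrt (1 - p) * Real.sqrt f₀) ^ 2 := by
    rw [mul_pow, mul_pow, ea, eb, ex, ey]
  rw [e4] at hpos ⊢
  clear e3 e4 em ea eb ex ey
  generalize Real.sqrt p = a at *
  generalize Real.sqrt (1 - p) = b at *
  generalize Real.sqrt f₀ = x at *
  generalize Real.sqrt f₁ = y at *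
  have hu : 0 ≤ a * y := by positivity
  have hv : 0 ≤ b * x := by positivity
  have hs : 0 < a * y + b * x := by
    by_contra h
    have h1 : a * y = 0 := by linarith
    have h2 : b * x = 0 := by linarith
    rw [h1, h2] at hpos
    norm_num at hpos
  constructor
  · have e : a * y + b * x - a * b * x * y / (a * y + b * x)
        = ((a * y) ^ 2 + (b * x) ^ 2 + (a * y) * (b * x)) / (a * y + b * x) := by
      field_simp
      ring
    rw [e]
    apply Real.sqrt_le_iff.2
    refine ⟨by positivity, ?_⟩
    rw [div_pow, le_div_iff₀ (by positivity)]
    nlinarith [sq_nonneg ((a * y) * (b * x))]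
  · apply sub_le_sub_left
    rw [div_mul_eq_mul_div, div_le_div_iff₀ (by positivity) hs]
    have key : min x y * (a * y + b * x) ≤ x * y * (a + b) := by
      have h1 : min x y * y ≤ x * y := mul_le_mul_of_nonneg_right (min_le_left _ _) hy
      have h2 : min x y * x ≤ y * x := mul_le_mul_of_nonneg_right (min_le_right _ _) hx
      nlinarith [mul_le_mul_of_nonneg_left h1 ha.le, mul_le_mul_of_nonneg_left h2 hb.le]
    have := mul_le_mul_of_nonneg_left key (mul_pos ha hb).le
    linarith
end

section
/- For every p ∈ (0,1) and γ ∈ (0,1), the Chernoff coefficient satisfies C_p^γ ≤ min{ p^{1−γ}(1 − γ + γ ℙ₁(𝒴₁)) + (1−p)^{1−γ}( ℙ₀₁(𝒴₀) · C₀^γ + (1−γ)((1−p)/p)^γ ℙ₀(𝒴₁) ), 1 }, where 𝒴₀ = {y : p f₁(y) < (1−p) f₀(y)}, 𝒴₁ = {y : p f₁(y) > (1−p) f₀(y)}, ℙ₀ and ℙ₁ denote the probability measures on ℝ with densities f₀ and f₁ respectively, and ℙ₀₁ denotes the probability measure with density f₀₁(y) = φ( y ; γμ/(1 + (1−γ)t)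 , ((1+t)/(1 + (1−γ)t)) · σ²/t ). -/
open MeasureTheory Real

/-- Gaussian probability density with mean `m` and variance `v`. -/
noncomputable def gaussPdf (m v y : ℝ) : ℝ :=
  Real.exp (-(y - m) ^ 2 / (2 * v)) / Real.sqrt (2 * Real.pi * v)

lemma aux_quad (a b c : ℝ) (ha : a ≠ 0) :
    (Polynomial.C a * Polynomial.X ^ 2 + Polynomial.C b * Polynomial.X + Polynomial.C c) ≠ 0 := by
  intro h
  have h2 := congrArg (fun Q => Polynomial.coeff Q 2) h
  simp at h2
  exact ha h2

lemma aux_gauss_eq (m v : ℝ) (hv : 0 < v) :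
    gaussPdf m v = ProbabilityTheory.gaussianPDFReal m ⟨v, hv.le⟩ := by
  funext y
  simp only [gaussPdf, ProbabilityTheory.gaussianPDFReal]
  rw [div_eq_mul_inv, mul_comm]
  rfl

lemma aux_gauss_int (m v : ℝ) (hv : 0 < v) : Integrable (gaussPdf m v) := by
  rw [aux_gauss_eq m v hv]
  exact ProbabilityTheory.integrable_gaussianPDFReal _ _

lemma aux_gauss_one (m v : ℝ) (hv : 0 < v) : ∫ y, gaussPdf m v y = 1 := by
  rw [aux_gauss_eq m v hv]
  refine ProbabilityTheory.integral_gaussianPDFReal_eq_one _ ?_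
  intro h
  exact hv.ne' (congrArg NNReal.toReal h)

lemma aux_gauss_pos (m v y : ℝ) (hv : 0 < v) : 0 < gaussPdf m v y := by
  unfold gaussPdf
  positivity

lemma aux_gauss_rpow (m v y g : ℝ) :
    gaussPdf m v y ^ g = exp (-(y - m) ^ 2 / (2 * v) * g) / √(2 * π * v) ^ g := by
  unfold gaussPdf
  rw [div_rpow (exp_pos _).le (sqrt_nonneg _), ← exp_mul]

lemma aux_bern (a b γ : ℝ) (ha : 0 < a) (hb : 0 < b) (h0 : 0 < γ) (h1 : γ < 1) :
    (a + b) ^ (1 - γ) ≤ a ^ (1 - γ) + (1 - γ) * b * a ^ (-γ) := by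
  have h := _root_.rpow_one_add_le_one_add_mul_self (s := b / a) (p := 1 - γ)
    (by linarith [div_pos hb ha]) (by linarith) (by linarith)
  have e : a + b = a * (1 + b / a) := by field_simp
  have e2 : a ^ (1 - γ) = a * a ^ (-γ) := by
    rw [sub_eq_add_neg, rpow_add ha, rpow_one]
  rw [e, mul_rpow ha.le (by positivity)]
  calc _ ≤ a ^ (1 - γ) * (1 + (1 - γ) * (b / a)) := by gcongr
    _ = _ := by rw [e2]; field_simp

lemma aux_split (x p γ : ℝ) (hx : 0 < x) (hp : 0 < p) :
    x ^ γ * (p * x) ^ (1 - γ) = p ^ (1 - γ) * x := by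
  rw [mul_rpow hp.le hx.le, mul_left_comm, ← rpow_add hx]
  simp

lemma aux_Y1 (x z p γ : ℝ) (hx : 0 < x) (hz : 0 < z) (hp : 0 < p) (hp1 : p < 1)
    (h0 : 0 < γ) (h1 : γ < 1) :
    x ^ γ * (p * x + (1 - p) * z) ^ (1 - γ) ≤
      p ^ (1 - γ) * x + (1 - p) ^ (1 - γ) * ((1 - γ) * ((1 - p) / p) ^ γ * z) := by
  have q : 0 < 1 - p := by linarith
  have h := aux_bern (p * x) ((1 - p) * z) γ (by positivity) (by positivity) h0 h1
  have e := aux_split x p γ hx hp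
  have e3 : x ^ γ * (p * x) ^ (-γ) = p ^ (-γ) := by
    rw [mul_rpow hp.le hx.le, mul_left_comm, ← rpow_add hx]
    simp
  have e4 : (1 - p) ^ (1 - γ) * ((1 - p) / p) ^ γ = (1 - p) * p ^ (-γ) := by
    rw [div_rpow q.le hp.le, rpow_neg hp.le, ← mul_div_assoc, ← rpow_add q]
    simp [div_eq_mul_inv]
  calc _ ≤ x ^ γ * ((p * x) ^ (1 - γ) + (1 - γ) * ((1 - p) * z) * (p * x) ^ (-γ)) := by gcongr
    _ = x ^ γ * (p * x) ^ (1 - γ) + (1 - γ) * ((1 - p) * z) * (x ^ γ * (p * x) ^ (-γ)) := by ring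
    _ = p ^ (1 - γ) * x + (1 - γ) * z * ((1 - p) * p ^ (-γ)) := by rw [e, e3]; ring
    _ = _ := by rw [← e4]; ring

lemma aux_Y0 (x z p γ : ℝ) (hx : 0 < x) (hz : 0 < z) (hp : 0 < p) (hp1 : p < 1)
    (h0 : 0 < γ) (h1 : γ < 1) (h : p * x < (1 - p) * z) :
    x ^ γ * (p * x + (1 - p) * z) ^ (1 - γ) ≤
      p ^ (1 - γ) * ((1 - γ) * x) + (1 - p) ^ (1 - γ) * (x ^ γ * z ^ (1 - γ)) := by
  have q : 0 < 1 - p := by linarith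
  have q2 : 0 < 1 - γ := by linarith
  have hb := aux_bern ((1 - p) * z) (p * x) γ (by positivity) (by positivity) h0 h1
  have hm : ((1 - p) * z) ^ (-γ) ≤ (p * x) ^ (-γ) :=
    rpow_le_rpow_of_nonpos (by positivity) h.le (by linarith)
  have e := aux_split x p γ hx hp
  have ha : 0 < p * x := by positivity
  have e2 : (p * x) ^ (1 - γ) = p * x * (p * x) ^ (-γ) := by
    rw [sub_eq_add_neg, rpow_add ha, rpow_one]
  rw [add_comm (p * x)]
  calc _ ≤ x ^ γ * (((1 - p) * z) ^ (1 - γ) + (1 - γ) * (p * x) * ((1 - p) * z) ^ (-γ)) := by gcongr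
    _ ≤ x ^ γ * (((1 - p) * z) ^ (1 - γ) + (1 - γ) * (p * x) * (p * x) ^ (-γ)) := by gcongr
    _ = x ^ γ * ((1 - p) * z) ^ (1 - γ) + (1 - γ) * (x ^ γ * (p * x) ^ (1 - γ)) := by rw [e2]; ring
    _ = _ := by rw [e, mul_rpow q.le hz.le]; ring

lemma aux_prod (μ σ t γ : ℝ) (hσ : 0 < σ) (ht : 0 < t) (h1 : γ < 1) :
    ∃ K : ℝ, ∀ y, gaussPdf μ (σ ^ 2 * (1 + 1 / t)) y ^ γ * gaussPdf 0 (σ ^ 2 / t) y ^ (1 - γ) =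
      K * gaussPdf (γ * μ / (1 + (1 - γ) * t)) (((1 + t) / (1 + (1 - γ) * t)) * (σ ^ 2 / t)) y := by
  have hd : 0 < 1 + (1 - γ) * t := by
    have : 0 < 1 - γ := by linarith
    positivity
  set m := γ * μ / (1 + (1 - γ) * t) with hm
  set v := ((1 + t) / (1 + (1 - γ) * t)) * (σ ^ 2 / t) with hv
  have hvp : 0 < v := by positivity
  refine ⟨exp (-(0 - μ) ^ 2 / (2 * (σ ^ 2 * (1 + 1 / t))) * γ + (0 - m) ^ 2 / (2 * v)) *
    √(2 * π * v) / (√(2 * π * (σ ^ 2 * (1 + 1 / t))) ^ γ * √(2 * π * (σ ^ 2 / t)) ^ (1 - γ)), ?_⟩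
  intro y
  rw [aux_gauss_rpow, aux_gauss_rpow, div_mul_div_comm, ← exp_add]
  have e : -(y - μ) ^ 2 / (2 * (σ ^ 2 * (1 + 1 / t))) * γ + -(y - 0) ^ 2 / (2 * (σ ^ 2 / t)) * (1 - γ)
      = (-(0 - μ) ^ 2 / (2 * (σ ^ 2 * (1 + 1 / t))) * γ + (0 - m) ^ 2 / (2 * v)) +
        -(y - m) ^ 2 / (2 * v) := by
    have ht1 : 1 + t ≠ 0 := by positivity
    have ht2 : t + 1 ≠ 0 := by positivity
    have e1 : 1 + 1 / t = (1 + t) / t := by field_simp; ring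
    rw [hm, hv, e1]
    have hd' := hd.ne'
    generalize hD : 1 + (1 - γ) * t = D at *
    field_simp
    subst hD
    ring
  have hs : √(2 * π * v) ≠ 0 := by positivity
  rw [e, exp_add]
  unfold gaussPdf
  field_simp

lemma aux_null (μ σ p t : ℝ) (hσ : 0 < σ) (ht : 0 < t) (hp : 0 < p) (hp1 : p < 1) :
    ∀ᵐ y : ℝ, p * gaussPdf μ (σ ^ 2 * (1 + 1 / t)) y ≠ (1 - p) * gaussPdf 0 (σ ^ 2 / t) y := by
  have q : 0 < 1 - p := by linarith
  set v1 := σ ^ 2 * (1 + 1 / t) with hv1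
  set v0 := σ ^ 2 / t with hv0
  have h1 : 0 < v1 := by positivity
  have h0 : 0 < v0 := by positivity
  have hne : v1 - v0 = σ ^ 2 := by rw [hv1, hv0]; field_simp; ring
  set c := log (p / √(2 * π * v1)) - log ((1 - p) / √(2 * π * v0)) with hc
  set P : Polynomial ℝ := .C (v1 - v0) * .X ^ 2 + .C (2 * μ * v0) * .X
    + .C (2 * v1 * v0 * c - v0 * μ ^ 2) with hP
  have hP0 : P ≠ 0 := by
    refine aux_quad _ _ _ ?_
    rw [hne]
    exact (pow_pos hσ 2).ne'
  have hfin : {y : ℝ | P.IsRoot y}.Finite := Polynomial.finite_setOfPred_isRoot hP0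
  have : ∀ᵐ y : ℝ, y ∉ {y : ℝ | P.IsRoot y} := measure_eq_zero_iff_ae_notMem.1 (hfin.measure_zero _)
  filter_upwards [this] with y hy heq
  apply hy
  have hl := congrArg log heq
  unfold gaussPdf at hl
  rw [mul_div_left_comm, mul_div_left_comm (1 - p), log_mul (exp_pos _).ne' (by positivity),
    log_mul (exp_pos _).ne' (by positivity), log_exp, log_exp] at hl
  have hc' : c = -(y - 0) ^ 2 / (2 * v0) - -(y - μ) ^ 2 / (2 * v1) := by linarith
  simp only [Polynomial.IsRoot, hP]
  simp only [Polynomial.eval_add, Polynomial.eval_mul, Polynomial.eval_C, Polynomial.eval_pow,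
    Polynomial.eval_X]
  rw [hc']
  field_simp
  ring

/-- Upper bound on the Chernoff coefficient `C_p^γ` in terms of `C₀^γ`
(first bound of Proposition 1). -/
theorem chernoff_coefficient_upper_bound (μ σ p t γ : ℝ) (hσ : 0 < σ) (ht : 0 < t)
    (hp : p ∈ Set.Ioo (0 : ℝ) 1) (hγ : γ ∈ Set.Ioo (0 : ℝ) 1)
    (f₀ f₁ f01 : ℝ → ℝ)
    (hf₀ : f₀ = fun y => gaussPdf 0 (σ ^ 2 / t) y)
    (hf₁ : f₁ = fun y => gaussPdf μ (σ ^ 2 * (1 + 1 / t)) y)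
    (hf01 : f01 = fun y =>
      gaussPdf (γ * μ / (1 + (1 - γ) * t)) (((1 + t) / (1 + (1 - γ) * t)) * (σ ^ 2 / t)) y)
    (Cp C0 : ℝ)
    (hCp : Cp = ∫ y : ℝ, (f₁ y) ^ γ * (p * f₁ y + (1 - p) * f₀ y) ^ (1 - γ))
    (hC0 : C0 = ∫ y : ℝ, (f₁ y) ^ γ * (f₀ y) ^ (1 - γ)) :
    Cp ≤ min
      (p ^ (1 - γ) * (1 - γ + γ * ∫ y in {y : ℝ | p * f₁ y > (1 - p) * f₀ y}, f₁ y)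
        + (1 - p) ^ (1 - γ) *
            ((∫ y in {y : ℝ | p * f₁ y < (1 - p) * f₀ y}, f01 y) * C0
              + (1 - γ) * ((1 - p) / p) ^ γ *
                  ∫ y in {y : ℝ | p * f₁ y > (1 - p) * f₀ y}, f₀ y))
      1 := by
  obtain ⟨hp0, hp1⟩ := hp
  obtain ⟨hg0, hg1⟩ := hγ
  have hq : 0 < 1 - p := by linarith
  have hgq : 0 < 1 - γ := by linarith
  have hd : 0 < 1 + (1 - γ) * t := by positivity
  have hv0 : 0 < σ ^ 2 / t := by positivity
  have hv1 : 0 < σ ^ 2 * (1 + 1 / t) := by positivity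
  have hv01 : 0 < ((1 + t) / (1 + (1 - γ) * t)) * (σ ^ 2 / t) := by positivity
  have i0 : Integrable f₀ := by rw [hf₀]; exact aux_gauss_int _ _ hv0
  have i1 : Integrable f₁ := by rw [hf₁]; exact aux_gauss_int _ _ hv1
  have i01 : Integrable f01 := by rw [hf01]; exact aux_gauss_int _ _ hv01
  have o0 : ∫ y, f₀ y = 1 := by rw [hf₀]; exact aux_gauss_one _ _ hv0
  have o1 : ∫ y, f₁ y = 1 := by rw [hf₁]; exact aux_gauss_one _ _ hv1
  have o01 : ∫ y, f01 y = 1 := by rw [hf01]; exact aux_gauss_one _ _ hv01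
  have p0 : ∀ y, 0 < f₀ y := fun y => by rw [hf₀]; exact aux_gauss_pos _ _ _ hv0
  have p1 : ∀ y, 0 < f₁ y := fun y => by rw [hf₁]; exact aux_gauss_pos _ _ _ hv1
  have hnull : ∀ᵐ y : ℝ, p * f₁ y ≠ (1 - p) * f₀ y := by
    rw [hf₀, hf₁]; exact aux_null μ σ p t hσ ht hp0 hp1
  have hK : ∀ y, f₁ y ^ γ * f₀ y ^ (1 - γ) = C0 * f01 y := by
    obtain ⟨K, hK⟩ := aux_prod μ σ t γ hσ ht hg1
    have hK' : ∀ y, f₁ y ^ γ * f₀ y ^ (1 - γ) = K * f01 y := by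
      rw [hf₀, hf₁, hf01]; exact hK
    have : C0 = K := by
      rw [hC0]; simp_rw [hK']; rw [integral_const_mul, o01, mul_one]
    rw [this]; exact hK'
  have m0 : Measurable f₀ := by rw [hf₀]; unfold gaussPdf; fun_prop
  have m1 : Measurable f₁ := by rw [hf₁]; unfold gaussPdf; fun_prop
  have hnn : ∀ y, 0 ≤ f₁ y ^ γ * (p * f₁ y + (1 - p) * f₀ y) ^ (1 - γ) := fun y => by
    have := p0 y
    have := p1 y
    positivity
  set Y1 := {y : ℝ | p * f₁ y > (1 - p) * f₀ y} with hY1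
  set Y0 := {y : ℝ | p * f₁ y < (1 - p) * f₀ y} with hY0
  have mY1 : MeasurableSet Y1 := measurableSet_lt (by fun_prop) (by fun_prop)
  have mY0 : MeasurableSet Y0 := measurableSet_lt (by fun_prop) (by fun_prop)
  rw [hCp]
  refine le_min ?_ ?_
  · set c := (1 - γ) * ((1 - p) / p) ^ γ with hc
    have j1 := i1.indicator mY1
    have j0 := i0.indicator mY1
    have j01 := i01.indicator mY0
    have a1 : Integrable fun y => (1 - γ) * f₁ y := i1.const_mul _
    have a2 : Integrable fun y => γ * Y1.indicator f₁ y := j1.const_mul _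
    have a3 : Integrable fun y => Y0.indicator f01 y * C0 := j01.mul_const _
    have a4 : Integrable fun y => c * Y1.indicator f₀ y := j0.const_mul _
    have a12 : Integrable fun y =>
      p ^ (1 - γ) * ((1 - γ) * f₁ y + γ * Y1.indicator f₁ y) := (a1.add a2).const_mul _
    have a34 : Integrable fun y =>
      (1 - p) ^ (1 - γ) * (Y0.indicator f01 y * C0 + c * Y1.indicator f₀ y) :=
        (a3.add a4).const_mul _
    calc _ ≤ ∫ y, (p ^ (1 - γ) * ((1 - γ) * f₁ y + γ * Y1.indicator f₁ y) +
          (1 - p) ^ (1 - γ) * (Y0.indicator f01 y * C0 + c * Y1.indicator f₀ y)) := by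
          refine integral_mono_of_nonneg (.of_forall hnn) (a12.add a34) ?_
          filter_upwards [hnull] with y hy
          rcases lt_or_gt_of_ne hy with h | h
          · have k0 : y ∈ Y0 := h
            have k1 : y ∉ Y1 := not_lt.2 h.le
            have := aux_Y0 _ _ p γ (p1 y) (p0 y) hp0 hp1 hg0 hg1 h
            rw [hK] at this
            simp only [Set.indicator_of_mem k0, Set.indicator_of_notMem k1]
            linarith
          · have k0 : y ∉ Y0 := not_lt.2 h.le
            have k1 : y ∈ Y1 := h
            have := aux_Y1 _ _ p γ (p1 y) (p0 y) hp0 hp1 hg0 hg1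
            simp only [Set.indicator_of_mem k1, Set.indicator_of_notMem k0]
            linarith
      _ = _ := by
          rw [integral_add a12 a34, integral_const_mul, integral_const_mul, integral_add a1 a2,
            integral_add a3 a4, integral_const_mul, integral_const_mul, integral_const_mul,
            integral_mul_const, integral_indicator mY1, integral_indicator mY1,
            integral_indicator mY0, o1, mul_one]
  · have b1 : Integrable fun y => γ * f₁ y := i1.const_mul _
    have b2 : Integrable fun y => p * f₁ y := i1.const_mul _
    have b3 : Integrable fun y => (1 - p) * f₀ y := i0.const_mul _
    have b4 : Integrable fun y => (1 - γ) * (p * f₁ y + (1 - p) * f₀ y) := (b2.add b3).const_mul _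
    calc _ ≤ ∫ y, (γ * f₁ y + (1 - γ) * (p * f₁ y + (1 - p) * f₀ y)) := by
          refine integral_mono_of_nonneg (.of_forall hnn) (b1.add b4) (.of_forall fun y => ?_)
          have := p0 y
          have := p1 y
          exact geom_mean_le_arith_mean2_weighted hg0.le hgq.le (p1 y).le (by positivity) (by ring)
      _ = 1 := by
          rw [integral_add b1 b4, integral_const_mul, integral_const_mul, integral_add b2 b3,
            integral_const_mul, integral_const_mul, o0, o1]
          ring
end

section
/- Let Y₁, …, Y_N be i.i.d. real random variables with common density f_p, and set P_i = p f₁(Y_i)/f_p(Y_i) for i = 1, …, N. For any γ ∈ (0,1) and any ε > 0, the event (1/N) ∑_{i=1}^N P_i^γ ≤ (1+ε) p^γ C_p^γ has probability at least 1 − exp( −(C_p^γ)² N p^γ ε² / ( 2( p^γ (C_p^{2γ} − (C_p^γ)²) + ε C_p^γ/3 ) ) ) when 0 < γ ≤ 1/2, and probability at least 1 − exp( −(C_p^γ)² N p^γ ε² / ( 2( p^{1−γ} − p^γ (C_p^γ)² + ε C_p^γ/3 ) ) ) when 1/2 < γ < 1, where C_p^{2γ} = ∫_ℝ f₁^{2γ}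 f_p^{1−2γ}. -/
open MeasureTheory ProbabilityTheory Real

lemma aux_g (x : ℝ) : exp x * (1 - x / 3) ≤ 1 + 2 * x / 3 + x ^ 2 / 6 := by
  set g : ℝ → ℝ := fun x => 1 + 2 * x / 3 + x ^ 2 / 6 - exp x * (1 - x / 3) with hg
  set g1 : ℝ → ℝ := fun x => 2 / 3 + x / 3 - exp x * (2 / 3 - x / 3) with hg1
  have d0 : ∀ x, HasDerivAt g (g1 x) x := by
    intro x
    have h := ((((hasDerivAt_id x).const_mul 2).div_const 3).const_add 1).add
      (((hasDerivAt_id x).pow 2).div_const 6) |>.sub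
      ((Real.hasDerivAt_exp x).mul (((hasDerivAt_id x).div_const 3).const_sub 1))
    refine (h.congr_of_eventuallyEq (Filter.Eventually.of_forall fun y => ?_)).congr_deriv ?_
    · simp [hg]
    · simp [hg1]; ring
  have d1 : ∀ x, HasDerivAt g1 ((1 - exp x * (1 - x)) / 3) x := by
    intro x
    have h := (((hasDerivAt_id x).div_const 3).const_add (2/3)).sub
      ((Real.hasDerivAt_exp x).mul (((hasDerivAt_id x).div_const 3).const_sub (2/3)))
    refine (h.congr_of_eventuallyEq (Filter.Eventually.of_forall fun y => ?_)).congr_deriv ?_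
    · simp [hg1]
    · simp; ring
  have m1 : Monotone g1 := by
    refine monotone_of_deriv_nonneg (fun x => (d1 x).differentiableAt) fun x => ?_
    rw [(d1 x).deriv]
    have h1 : 1 - x ≤ exp (-x) := by linarith [Real.add_one_le_exp (-x)]
    have h2 : exp x * (1 - x) ≤ exp x * exp (-x) := by gcongr
    rw [← Real.exp_add, add_neg_cancel, Real.exp_zero] at h2
    linarith
  have h10 : g1 0 = 0 := by simp [hg1]
  have h00 : g 0 = 0 := by simp [hg]
  have hc : Continuous g := continuous_iff_continuousAt.2 fun x => (d0 x).continuousAt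
  have key : 0 ≤ g x := by
    rw [← h00]
    rcases le_total 0 x with hx | hx
    · refine monotoneOn_of_deriv_nonneg (convex_Ici 0) hc.continuousOn
        (fun x _ => (d0 x).differentiableAt.differentiableWithinAt) ?_ (Set.self_mem_Ici) hx hx
      intro y hy
      rw [interior_Ici] at hy
      rw [(d0 y).deriv, ← h10]
      exact m1 (le_of_lt hy)
    · refine antitoneOn_of_deriv_nonpos (convex_Iic 0) hc.continuousOn
        (fun x _ => (d0 x).differentiableAt.differentiableWithinAt) ?_ hx (Set.self_mem_Iic) hx
      intro y hy
      rw [interior_Iic] at hy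
      rw [(d0 y).deriv, ← h10]
      exact m1 (le_of_lt hy)
  simp only [hg] at key
  linarith

lemma aux_exp (x l : ℝ) (hx : x ≤ l) (hl : l < 3) :
    exp x ≤ 1 + x + x ^ 2 * (1 / (2 * (1 - l / 3))) := by
  have h := aux_g x
  have h3 : 0 < 1 - x / 3 := by linarith
  have h4 : 0 < 1 - l / 3 := by linarith
  have h1 : exp x ≤ 1 + x + x ^ 2 * (1 / (2 * (1 - x / 3))) := by
    have e : 1 + x + x ^ 2 * (1 / (2 * (1 - x / 3)))
      = (1 + 2 * x / 3 + x ^ 2 / 6) / (1 - x / 3) := by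
      have : 3 - x ≠ 0 := by linarith
      field_simp
      ring
    rw [e, le_div_iff₀ h3]; exact h
  refine h1.trans ?_
  gcongr

lemma bern {N : ℕ} {Ω : Type*} [MeasurableSpace Ω] (Pr : Measure Ω) [IsProbabilityMeasure Pr]
    (X : Fin N → Ω → ℝ) (hX : ∀ i, Measurable (X i)) (hi : iIndepFun X Pr)
    (h0 : ∀ i ω, 0 ≤ X i ω) (h1 : ∀ i ω, X i ω ≤ 1) (m q V s : ℝ)
    (hm : ∀ i, ∫ ω, X i ω ∂Pr = m) (hq : ∀ i, ∫ ω, (X i ω) ^ 2 ∂Pr = q)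
    (hV : q - m ^ 2 ≤ V) (hV0 : 0 ≤ V) (hs : 0 ≤ s) :
    Pr.real {ω | N * (m + s) ≤ ∑ i, X i ω} ≤ exp (-(N * s ^ 2) / (2 * (V + s / 3))) := by
  rcases hs.eq_or_lt with rfl | hs
  · simp
  have bint : ∀ (f : Ω → ℝ) (C : ℝ), Measurable f → (∀ ω, |f ω| ≤ C) → Integrable f Pr := by
    intro f C hf hb
    exact Integrable.of_bound hf.aestronglyMeasurable C (Filter.Eventually.of_forall hb)
  have i1 : ∀ i, Integrable (X i) Pr := fun i => bint _ 1 (hX i) fun ω => by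
    rw [abs_of_nonneg (h0 i ω)]; exact h1 i ω
  have i2 : ∀ i, Integrable (fun ω => (X i ω) ^ 2) Pr := fun i =>
    bint _ 1 ((hX i).pow_const 2) fun ω => by
      rw [abs_of_nonneg (sq_nonneg _)]; exact pow_le_one₀ (h0 i ω) (h1 i ω)
  have ie : ∀ l, 0 ≤ l → ∀ i, Integrable (fun ω => exp (l * X i ω)) Pr := fun l hl i =>
    bint _ (exp l) (by have := hX i; fun_prop) fun ω => by
      rw [abs_of_pos (exp_pos _)]; gcongr; nlinarith [h1 i ω]
  have hmgf : ∀ l, 0 ≤ l → l < 3 → ∀ i,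
      mgf (X i) Pr l ≤ exp (l * m + l ^ 2 * V * (1 / (2 * (1 - l / 3)))) := by
    intro l hl hl3 i
    have h4 : 0 < 1 - l / 3 := by linarith
    set c := 1 / (2 * (1 - l / 3)) with hc
    have hc0 : 0 ≤ c := by positivity
    have hm0 : 0 ≤ m := by rw [← hm i]; exact integral_nonneg (h0 i)
    have hb : mgf (X i) Pr l ≤ ∫ ω, exp (l * m) *
        ((1 - l * m + l ^ 2 * m ^ 2 * c) + (l - 2 * l ^ 2 * m * c) * X i ω
          + l ^ 2 * c * (X i ω) ^ 2) ∂Pr := by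
      refine integral_mono (ie l hl i) ?_ fun ω => ?_
      · exact ((((integrable_const _).add ((i1 i).const_mul _))).add ((i2 i).const_mul _)).const_mul _
      · have := aux_exp (l * (X i ω - m)) l (by nlinarith [h1 i ω]) hl3
        have e : exp (l * X i ω) = exp (l * m) * exp (l * (X i ω - m)) := by
          rw [← exp_add]; ring_nf
        simp only
        rw [e]
        gcongr
        refine this.trans (le_of_eq ?_)
        rw [← hc]; ring
    refine hb.trans ?_
    rw [integral_const_mul, integral_add, integral_add, integral_const_mul, integral_const_mul,
      hm, hq, integral_const, exp_add]
    rotate_left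
    · exact integrable_const _
    · exact (i1 i).const_mul _
    · exact (integrable_const _).add ((i1 i).const_mul _)
    · exact (i2 i).const_mul _
    gcongr
    simp only [probReal_univ, smul_eq_mul, one_mul]
    have := Real.add_one_le_exp (l ^ 2 * V * c)
    have : l ^ 2 * c * (q - m ^ 2) ≤ l ^ 2 * c * V := by gcongr
    nlinarith
  have main : ∀ l, 0 ≤ l → l < 3 → Pr.real {ω | N * (m + s) ≤ ∑ i, X i ω} ≤
      exp (N * (-(l * s) + l ^ 2 * V * (1 / (2 * (1 - l / 3))))) := by
    intro l hl hl3
    have hsum := hi.mgf_sum (t := l) hX Finset.univ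
    have hint : Integrable (fun ω => exp (l * (∑ i, X i) ω)) Pr := by
      refine bint _ (exp (l * N)) (by simp only [Finset.sum_apply]; fun_prop) fun ω => ?_
      rw [abs_of_pos (exp_pos _)]; gcongr
      simp only [Finset.sum_apply]
      calc ∑ i, X i ω ≤ ∑ i : Fin N, (1 : ℝ) := Finset.sum_le_sum fun i _ => h1 i ω
        _ = N := by simp
    have hch := measure_ge_le_exp_mul_mgf (X := ∑ i, X i) (μ := Pr) (N * (m + s)) hl hint
    simp only [Finset.sum_apply] at hch
    refine hch.trans ?_
    rw [hsum]
    calc _ ≤ exp (-l * (N * (m + s))) *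
          ∏ i : Fin N, exp (l * m + l ^ 2 * V * (1 / (2 * (1 - l / 3)))) := by
          gcongr with i _
          · intro i _; exact mgf_nonneg
          · exact hmgf l hl hl3 i
      _ = _ := by
          rw [Finset.prod_const, ← exp_nat_mul, ← exp_add]
          simp only [Finset.card_univ, Fintype.card_fin]
          ring_nf
  rcases hV0.eq_or_lt with rfl | hV0
  · refine (main (3/2) (by norm_num) (by norm_num)).trans (le_of_eq ?_)
    congr 1
    field_simp
    ring
  · refine (main (s / (V + s / 3)) (by positivity) ?_).trans (le_of_eq ?_)
    · rw [div_lt_iff₀ (by positivity)]; linarith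
    · congr 1
      have e : 1 - s / (V + s / 3) / 3 = V / (V + s / 3) := by
        field_simp; ring
      rw [e]
      field_simp
      ring

lemma var_nonneg_aux {Ω : Type*} [MeasurableSpace Ω] (Pr : Measure Ω) [IsProbabilityMeasure Pr]
    (X : Ω → ℝ) (hX : Measurable X) (h0 : ∀ ω, 0 ≤ X ω) (h1 : ∀ ω, X ω ≤ 1) :
    0 ≤ (∫ ω, (X ω) ^ 2 ∂Pr) - (∫ ω, X ω ∂Pr) ^ 2 := by
  have hL : MemLp X 2 Pr := MemLp.of_bound hX.aestronglyMeasurable 1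
    (Filter.Eventually.of_forall fun ω => by
      rw [Real.norm_eq_abs, abs_of_nonneg (h0 ω)]; exact h1 ω)
  have h := variance_nonneg X Pr
  rw [variance_eq_sub hL] at h
  simpa using h

lemma gaussPdf_eq (m v : ℝ) (hv : 0 < v) :
    gaussPdf m v = gaussianPDFReal m ⟨v, hv.le⟩ := by
  funext y
  simp only [gaussPdf, gaussianPDFReal]
  rw [div_eq_mul_inv, mul_comm]
  rfl

/-- Bernstein-type tail bound for the sample average of `P_i^γ` (Lemma 1). -/
theorem tail_bound_sample_average_pgamma (μ σ p t γ ε : ℝ) (hσ : 0 < σ) (ht : 0 < t)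
    (hp : p ∈ Set.Ioo (0 : ℝ) 1) (hγ : γ ∈ Set.Ioo (0 : ℝ) 1) (hε : 0 < ε)
    (f₀ f₁ fp : ℝ → ℝ)
    (hf₀ : f₀ = fun y => gaussPdf 0 (σ ^ 2 / t) y)
    (hf₁ : f₁ = fun y => gaussPdf μ (σ ^ 2 * (1 + 1 / t)) y)
    (hfp : fp = fun y => p * f₁ y + (1 - p) * f₀ y)
    (Cp C2p : ℝ)
    (hCp : Cp = ∫ y : ℝ, (f₁ y) ^ γ * (fp y) ^ (1 - γ))
    (hC2p : C2p = ∫ y : ℝ, (f₁ y) ^ (2 * γ) * (fp y) ^ (1 - 2 * γ))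
    (N : ℕ) (hN : 1 ≤ N)
    (Ω : Type*) [MeasurableSpace Ω] (Pr : Measure Ω) [IsProbabilityMeasure Pr]
    (Y : Fin N → Ω → ℝ) (hYm : ∀ i, Measurable (Y i))
    (hYindep : iIndepFun Y Pr)
    (hYdist : ∀ i, Measure.map (Y i) Pr
      = volume.withDensity (fun y => ENNReal.ofReal (fp y))) :
    ENNReal.ofReal
      (if γ ≤ 1 / 2 then
        1 - Real.exp (-(Cp ^ 2 * N * p ^ γ * ε ^ 2)
              / (2 * (p ^ γ * (C2p - Cp ^ 2) + ε * Cp / 3)))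
      else
        1 - Real.exp (-(Cp ^ 2 * N * p ^ γ * ε ^ 2)
              / (2 * (p ^ (1 - γ) - p ^ γ * Cp ^ 2 + ε * Cp / 3))))
      ≤ Pr {ω | (1 / N : ℝ) * ∑ i, (p * f₁ (Y i ω) / fp (Y i ω)) ^ γ
            ≤ (1 + ε) * p ^ γ * Cp} := by
  obtain ⟨hp0, hp1⟩ := hp
  obtain ⟨hγ0, hγ1⟩ := hγ
  have hv0 : 0 < σ ^ 2 / t := by positivity
  have hv1 : 0 < σ ^ 2 * (1 + 1 / t) := by positivity
  have hf₀p : ∀ y, 0 < f₀ y := fun y => by rw [hf₀]; simp only [gaussPdf]; positivity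
  have hf₁p : ∀ y, 0 < f₁ y := fun y => by rw [hf₁]; simp only [gaussPdf]; positivity
  have hf₀m : Measurable f₀ := by rw [hf₀]; unfold gaussPdf; fun_prop
  have hf₁m : Measurable f₁ := by rw [hf₁]; unfold gaussPdf; fun_prop
  have hf₁i : ∫ y, f₁ y = 1 := by
    have : f₁ = gaussianPDFReal μ ⟨_, hv1.le⟩ := by rw [hf₁]; exact gaussPdf_eq _ _ hv1
    rw [this]
    exact integral_gaussianPDFReal_eq_one μ (fun h => hv1.ne' (congrArg NNReal.toReal h))
  have hlt : ∀ y, p * f₁ y ≤ fp y := fun y => by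
    rw [hfp]; simp only; nlinarith [hf₀p y]
  have hfpp : ∀ y, 0 < fp y := fun y => lt_of_lt_of_le (mul_pos hp0 (hf₁p y)) (hlt y)
  have hfpm : Measurable fp := by rw [hfp]; fun_prop
  clear hf₀ hf₁ hfp
  set P : ℝ → ℝ := fun y => p * f₁ y / fp y with hP
  have hP0 : ∀ y, 0 < P y := fun y => div_pos (mul_pos hp0 (hf₁p y)) (hfpp y)
  have hP1 : ∀ y, P y ≤ 1 := fun y => (div_le_one (hfpp y)).2 (hlt y)
  have hPm : Measurable P := by rw [hP]; fun_prop
  have hE : ∀ i (g : ℝ → ℝ), Measurable g → ∫ ω, g (Y i ω) ∂Pr = ∫ y, fp y * g y := by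
    intro i g hg
    rw [← integral_map (hYm i).aemeasurable hg.aestronglyMeasurable, hYdist i,
      integral_withDensity_eq_integral_toReal_smul (by fun_prop)
        (Filter.Eventually.of_forall fun _ => ENNReal.ofReal_lt_top)]
    refine integral_congr_ae (Filter.Eventually.of_forall fun y => ?_)
    simp [ENNReal.toReal_ofReal (hfpp y).le]
  have hpow : ∀ (a : ℝ) (y : ℝ), fp y * P y ^ a = p ^ a * (f₁ y ^ a * fp y ^ (1 - a)) := by
    intro a y
    simp only [hP]
    rw [div_rpow (mul_pos hp0 (hf₁p y)).le (hfpp y).le, mul_rpow hp0.le (hf₁p y).le,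
      rpow_sub (hfpp y), rpow_one]
    ring
  have hEa : ∀ (i : Fin N) (a : ℝ), ∫ ω, P (Y i ω) ^ a ∂Pr = p ^ a * ∫ y, f₁ y ^ a * fp y ^ (1 - a) := by
    intro i a
    rw [hE i (fun y => P y ^ a) (hPm.pow_const a), ← integral_const_mul]
    simp only [hpow]
  set X : Fin N → Ω → ℝ := fun i ω => P (Y i ω) ^ γ with hXd
  have hXm : ∀ i, Measurable (X i) := fun i => (hPm.comp (hYm i)).pow_const γ
  have hXi : iIndepFun X Pr := hYindep.comp (fun _ y => P y ^ γ) (fun _ => hPm.pow_const γ)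
  have hX0 : ∀ i ω, 0 ≤ X i ω := fun i ω => (rpow_pos_of_pos (hP0 _) _).le
  have hX1 : ∀ i ω, X i ω ≤ 1 := fun i ω => rpow_le_one (hP0 _).le (hP1 _) hγ0.le
  have hm : ∀ i, ∫ ω, X i ω ∂Pr = p ^ γ * Cp := fun i => by rw [hCp]; exact hEa i γ
  have hX2 : ∀ i ω, X i ω ^ 2 = P (Y i ω) ^ (2 * γ) := fun i ω => by
    simp only [hXd]
    rw [← rpow_natCast, ← rpow_mul (hP0 _).le]
    congr 1
    push_cast
    ring
  have hq : ∀ i, ∫ ω, X i ω ^ 2 ∂Pr = p ^ (2 * γ) * C2p := fun i => by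
    simp only [hX2]
    rw [hC2p]; exact hEa i (2 * γ)
  have i0 : Fin N := ⟨0, hN⟩
  have hvar : 0 ≤ p ^ (2 * γ) * C2p - (p ^ γ * Cp) ^ 2 := by
    have := var_nonneg_aux Pr (X i0) (hXm i0) (hX0 i0) (hX1 i0)
    rwa [hm, hq] at this
  have hpg : 0 < p ^ γ := rpow_pos_of_pos hp0 _
  have hp2 : p ^ (2 * γ) = p ^ γ * p ^ γ := by rw [two_mul, rpow_add hp0]
  have hCp0 : 0 ≤ Cp := by
    rw [hCp]
    exact integral_nonneg fun y =>
      (mul_pos (rpow_pos_of_pos (hf₁p y) _) (rpow_pos_of_pos (hfpp y) _)).le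
  have hNp : (0 : ℝ) < N := by exact_mod_cast hN
  have hfin : ∀ D : ℝ, p ^ γ * (C2p - Cp ^ 2) ≤ D →
      ENNReal.ofReal (1 - Real.exp (-(Cp ^ 2 * N * p ^ γ * ε ^ 2) / (2 * (D + ε * Cp / 3))))
      ≤ Pr {ω | (1 / N : ℝ) * ∑ i, X i ω ≤ (1 + ε) * p ^ γ * Cp} := by
    intro D hD
    have hle : p ^ (2 * γ) * C2p - (p ^ γ * Cp) ^ 2 ≤ p ^ γ * D := by
      calc _ = p ^ γ * (p ^ γ * (C2p - Cp ^ 2)) := by rw [hp2]; ring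
        _ ≤ _ := by gcongr
    have hb := bern Pr X hXm hXi hX0 hX1 (p ^ γ * Cp) (p ^ (2 * γ) * C2p) (p ^ γ * D)
      (ε * (p ^ γ * Cp)) hm hq hle (hvar.trans hle) (by positivity)
    have he : -(N * (ε * (p ^ γ * Cp)) ^ 2) / (2 * (p ^ γ * D + ε * (p ^ γ * Cp) / 3))
        = -(Cp ^ 2 * N * p ^ γ * ε ^ 2) / (2 * (D + ε * Cp / 3)) := by
      rw [← mul_div_mul_left (-(Cp ^ 2 * N * p ^ γ * ε ^ 2)) (2 * (D + ε * Cp / 3)) hpg.ne']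
      congr 1 <;> ring
    rw [he] at hb
    set S : Set Ω := {ω | (1 / N : ℝ) * ∑ i, X i ω ≤ (1 + ε) * p ^ γ * Cp} with hS
    have hSm : MeasurableSet S := measurableSet_le (by fun_prop) measurable_const
    have hsub : Sᶜ ⊆ {ω | N * (p ^ γ * Cp + ε * (p ^ γ * Cp)) ≤ ∑ i, X i ω} := by
      intro ω hω
      simp only [hS, Set.mem_compl_iff, Set.mem_setOf_eq, not_le] at hω ⊢
      rw [one_div, inv_mul_eq_div, lt_div_iff₀ hNp] at hω
      linarith
    have h1 : Pr.real Sᶜ ≤ _ := (measureReal_mono hsub).trans hb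
    rw [probReal_compl_eq_one_sub hSm] at h1
    rw [← ofReal_measureReal (μ := Pr) (s := S)]
    exact ENNReal.ofReal_le_ofReal (by linarith)
  split_ifs with hc
  · exact hfin _ le_rfl
  · refine hfin _ ?_
    have hq1 : p ^ (2 * γ) * C2p ≤ p := by
      rw [← hq i0]
      have hPi : ∫ ω, P (Y i0 ω) ∂Pr = p := by
        have := hEa i0 1
        simpa [hf₁i] using this
      rw [← hPi]
      have bd : ∀ f : Ω → ℝ, Measurable f → (∀ ω, 0 ≤ f ω) → (∀ ω, f ω ≤ 1) →
          Integrable f Pr := fun f hf h0 h1 =>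
        Integrable.of_bound hf.aestronglyMeasurable 1 (Filter.Eventually.of_forall fun ω => by
          rw [Real.norm_eq_abs, abs_of_nonneg (h0 ω)]; exact h1 ω)
      refine integral_mono (bd _ ((hXm i0).pow_const 2) (fun ω => sq_nonneg _)
        fun ω => pow_le_one₀ (hX0 _ _) (hX1 _ _))
        (bd _ (hPm.comp (hYm i0)) (fun ω => (hP0 _).le) fun ω => hP1 _) fun ω => ?_
      simp only [hX2]
      calc P (Y i0 ω) ^ (2 * γ) ≤ P (Y i0 ω) ^ (1 : ℝ) :=
            rpow_le_rpow_of_exponent_ge (hP0 _) (hP1 _) (by linarith)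
        _ = _ := rpow_one _
    have hpp : p ^ γ * p ^ (1 - γ) = p := by
      rw [← rpow_add hp0]; simp
    have : p ^ γ * C2p ≤ p ^ (1 - γ) := by
      refine le_of_mul_le_mul_left ?_ hpg
      rw [hpp, ← mul_assoc, ← hp2]; exact hq1
    linarith
end

section
/- For every q > 0, α ≥ 0 and β > 0, the function x ↦ ( α + β x^{−2/q} )^{−q/2} is concave on the interval (0, ∞). -/
/-- The function `x ↦ (α + β x^{−2/q})^{−q/2}` is concave on `(0, ∞)`. -/
theorem concave_alpha_beta_rpow (q α β : ℝ) (hq : 0 < q) (hα : 0 ≤ α) (hβ : 0 < β) :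
    ConcaveOn ℝ (Set.Ioi (0 : ℝ))
      (fun x : ℝ => (α + β * x ^ (-(2 / q))) ^ (-(q / 2))) := by
  have hd : ∀ x : ℝ, 0 < x → HasDerivAt (fun x : ℝ => (α + β * x ^ (-(2 / q))) ^ (-(q / 2)))
      (β * (α * x ^ (2 / q) + β) ^ (-(q / 2) - 1)) x := by
    intro x hx
    have hu : 0 < α + β * x ^ (-(2 / q)) := by positivity
    have h1 : HasDerivAt (fun x : ℝ => α + β * x ^ (-(2 / q)))
        (β * (-(2 / q) * x ^ (-(2 / q) - 1))) x :=
      ((Real.hasDerivAt_rpow_const (Or.inl hx.ne')).const_mul β).const_add α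
    have h2 := h1.rpow_const (p := -(q / 2)) (Or.inl hu.ne')
    refine h2.congr_deriv ?_
    have hxp : 0 < x ^ (2 / q) := by positivity
    have e1 : α * x ^ (2 / q) + β = x ^ (2 / q) * (α + β * x ^ (-(2 / q))) := by
      rw [Real.rpow_neg hx.le]; field_simp
    have e2 : (x ^ (2 / q)) ^ (-(q / 2) - 1) = x ^ (-(2 / q) - 1) := by
      rw [← Real.rpow_mul hx.le]; congr 1; field_simp; ring
    rw [e1, Real.mul_rpow hxp.le hu.le, e2]
    field_simp
  apply AntitoneOn.concaveOn_of_deriv (convex_Ioi 0)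
  · exact fun x hx => (hd x hx).continuousAt.continuousWithinAt
  · rw [interior_Ioi]
    exact fun x hx => (hd x hx).differentiableAt.differentiableWithinAt
  · rw [interior_Ioi]
    intro x hx y hy hxy
    rw [(hd x hx).deriv, (hd y hy).deriv]
    have hx' : 0 < x := hx
    apply mul_le_mul_of_nonneg_left _ hβ.le
    apply Real.rpow_le_rpow_of_nonpos (by positivity)
    · gcongr
    · have : 0 < q / 2 := by positivity
      linarith
end

section
/- Let q > 0, γ = 2/(q+2), and α, β > 0. Let f₀, f₁ be probability densities on ℝ, p ∈ (0,1), f_p = p f₁ + (1−p) f₀, and define P(y) = p f₁(y)/f_p(y) where f_p(y) > 0 and P(y) = 0 otherwise. Then ∫_ℝ P(y) · ( α + β P(y)^γ )^{−q/2} f_p(y) dy ≤ p · ( α + β ( p^{−(1−γ)} C_p^γ )^{−2/q} )^{−q/2}. -/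
open MeasureTheory

/-- tangent line bound -/
lemma tangent_aux (s α β m u : ℝ) (hs : 0 < s) (hα : 0 < α) (hβ : 0 < β) (hm : 0 < m)
    (hu : 0 < u) :
    (α + β * u ^ (-s)) ^ (-(1 / s)) ≤
      (α + β * m ^ (-s)) ^ (-(1 / s)) / (α + β * m ^ (-s)) * (α + β * m ^ (-s) * (u / m)) := by
  have hM : 0 < m ^ (-s) := Real.rpow_pos_of_pos hm _
  set M := m ^ (-s) with hMdef
  have hD : 0 < α + β * M := by positivity
  set D := α + β * M with hDdef
  set t := u / m with ht
  have htp : 0 < t := by positivity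
  have hut : u ^ (-s) = M * t ^ (-s) := by
    rw [hMdef, ← Real.mul_rpow hm.le htp.le]
    congr 1
    rw [ht]; field_simp
  have hT : 0 < t ^ (-s) := Real.rpow_pos_of_pos htp _
  have hX : 0 < α / D + β * M / D * t := by positivity
  have hsum : α / D + β * M / D = 1 := by rw [← add_div]; exact div_self hD.ne'
  have hconv : (α / D + β * M / D * t) ^ (-s) ≤ α / D + β * M / D * t ^ (-s) := by
    have g1 := Real.geom_mean_le_arith_mean2_weighted (w₁ := α / D) (w₂ := β * M / D)
      (p₁ := 1) (p₂ := t) (by positivity) (by positivity) zero_le_one htp.le hsum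
    have g2 := Real.geom_mean_le_arith_mean2_weighted (w₁ := α / D) (w₂ := β * M / D)
      (p₁ := 1) (p₂ := t ^ (-s)) (by positivity) (by positivity) zero_le_one hT.le hsum
    simp only [Real.one_rpow, one_mul, mul_one] at g1 g2
    refine le_trans ?_ g2
    rw [← Real.rpow_mul htp.le, mul_comm (-s), Real.rpow_mul htp.le]
    exact Real.rpow_le_rpow_of_nonpos (Real.rpow_pos_of_pos htp _) g1 (by linarith)
  have h2 : (α / D + β * M / D * t ^ (-s)) ^ (-(1 / s)) ≤ α / D + β * M / D * t := by
    have := Real.rpow_le_rpow_of_nonpos (z := -(1 / s)) (Real.rpow_pos_of_pos hX (-s)) hconv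
      (by simp; positivity)
    rwa [← Real.rpow_mul hX.le, show -s * -(1 / s) = 1 by field_simp, Real.rpow_one] at this
  have h3 : α + β * u ^ (-s) = D * (α / D + β * M / D * t ^ (-s)) := by
    rw [hut]; field_simp
  rw [h3, Real.mul_rpow hD.le (by positivity)]
  calc _ ≤ D ^ (-(1 / s)) * (α / D + β * M / D * t) := by gcongr
    _ = _ := by field_simp

/-- Jensen-type bound on the expected second-stage cost (general densities). -/
theorem jensen_bound_expected_cost (q γ α β : ℝ) (hq : 0 < q) (hγ : γ = 2 / (q + 2))
    (hα : 0 < α) (hβ : 0 < β)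
    (f₀ f₁ : ℝ → ℝ) (hm₀ : Measurable f₀) (hm₁ : Measurable f₁)
    (h₀ : ∀ y, 0 ≤ f₀ y) (h₁ : ∀ y, 0 ≤ f₁ y)
    (hi₀ : (∫ y : ℝ, f₀ y) = 1) (hi₁ : (∫ y : ℝ, f₁ y) = 1)
    (p : ℝ) (hp : p ∈ Set.Ioo (0 : ℝ) 1)
    (fp : ℝ → ℝ) (hfp : fp = fun y => p * f₁ y + (1 - p) * f₀ y)
    (P : ℝ → ℝ)
    (hP : P = fun y => if 0 < fp y then p * f₁ y / fp y else 0)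
    (Cp : ℝ) (hCp : Cp = ∫ y : ℝ, (f₁ y) ^ γ * (fp y) ^ (1 - γ)) :
    (∫ y : ℝ, P y * (α + β * (P y) ^ γ) ^ (-(q / 2)) * fp y)
      ≤ p * (α + β * (p ^ (-(1 - γ)) * Cp) ^ (-(2 / q))) ^ (-(q / 2)) := by
  obtain ⟨hp0, hp1⟩ := hp
  have hγ0 : 0 < γ := by rw [hγ]; positivity
  have hγ1 : 1 - γ = q / (q + 2) := by rw [hγ]; field_simp; ring
  have hγ1p : 0 < 1 - γ := by rw [hγ1]; positivity
  have I0 : Integrable f₀ := by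
    by_contra h; rw [integral_undef h] at hi₀; norm_num at hi₀
  have I1 : Integrable f₁ := by
    by_contra h; rw [integral_undef h] at hi₁; norm_num at hi₁
  have hmp : Measurable fp := by rw [hfp]; fun_prop
  have Ip : Integrable fp := by rw [hfp]; exact (I1.const_mul _).add (I0.const_mul _)
  have hfle : ∀ y, p * f₁ y ≤ fp y := by
    intro y; rw [hfp]; have := mul_nonneg (sub_nonneg.2 hp1.le) (h₀ y); simp only; linarith
  have hfp0 : ∀ y, 0 ≤ fp y := fun y => (mul_nonneg hp0.le (h₁ y)).trans (hfle y)
  have IC : Integrable (fun y => (f₁ y) ^ γ * (fp y) ^ (1 - γ)) := by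
    refine Integrable.mono' ((I1.const_mul γ).add (Ip.const_mul (1 - γ)))
      (by exact ((hm₁.pow_const _).mul (hmp.pow_const _)).aestronglyMeasurable) ?_
    refine Filter.Eventually.of_forall fun y => ?_
    have a1 := Real.rpow_nonneg (h₁ y) γ
    have a2 := Real.rpow_nonneg (hfp0 y) (1 - γ)
    rw [Real.norm_of_nonneg (mul_nonneg a1 a2)]
    exact Real.geom_mean_le_arith_mean2_weighted hγ0.le hγ1p.le (h₁ y) (hfp0 y) (by ring)
  have hCge : p ^ (1 - γ) ≤ Cp := by
    rw [hCp]
    calc p ^ (1 - γ) = ∫ y, p ^ (1 - γ) * f₁ y := by rw [integral_const_mul, hi₁, mul_one]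
      _ ≤ _ := by
        refine integral_mono (I1.const_mul _) IC fun y => ?_
        have e : p ^ (1 - γ) * f₁ y = f₁ y ^ γ * (p * f₁ y) ^ (1 - γ) := by
          rw [Real.mul_rpow hp0.le (h₁ y), mul_left_comm, ← Real.rpow_add_of_nonneg (h₁ y) hγ0.le hγ1p.le]
          simp
        simp only
        rw [e]
        have a1 := Real.rpow_nonneg (h₁ y) γ
        have a3 := mul_nonneg hp0.le (h₁ y)
        gcongr
        exact hfle y
  have hCpos : 0 < Cp := (Real.rpow_pos_of_pos hp0 _).trans_le hCge
  have hr : 0 < p ^ (-(1 - γ)) := Real.rpow_pos_of_pos hp0 _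
  set r := p ^ (-(1 - γ)) with hrdef
  set m := r * Cp with hmdef
  have hm : 0 < m := by positivity
  have hM : 0 < m ^ (-(2 / q)) := Real.rpow_pos_of_pos hm _
  set M := m ^ (-(2 / q)) with hMdef
  have hD : 0 < α + β * M := by positivity
  have hE : 0 < (α + β * M) ^ (-(q / 2)) := Real.rpow_pos_of_pos hD _
  set E := (α + β * M) ^ (-(q / 2)) with hEdef
  set c := p * (E / (α + β * M)) with hc
  have hc0 : 0 < c := by positivity
  have hP0 : ∀ y, 0 ≤ P y := by
    intro y; rw [hP]; simp only; split_ifs with h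
    · exact div_nonneg (mul_nonneg hp0.le (h₁ y)) h.le
    · exact le_rfl
  have key : ∀ y, P y * (α + β * (P y) ^ γ) ^ (-(q / 2)) * fp y ≤
      c * α * f₁ y + c * β * M / m * r * ((f₁ y) ^ γ * (fp y) ^ (1 - γ)) := by
    intro y
    rcases (h₁ y).eq_or_lt with h | h
    · have : P y = 0 := by rw [hP]; simp [← h]
      rw [this, ← h]
      have a1 : (0:ℝ) ≤ 0 ^ γ := Real.rpow_nonneg le_rfl γ
      have a2 := Real.rpow_nonneg (hfp0 y) (1 - γ)
      simp only [zero_mul, mul_zero, zero_add]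
      positivity
    · have hf : 0 < fp y := (mul_pos hp0 h).trans_le (hfle y)
      have hPy : P y = p * f₁ y / fp y := by rw [hP]; simp [hf]
      have hPpos : 0 < P y := by rw [hPy]; positivity
      have hu : 0 < P y ^ (-(1 - γ)) := Real.rpow_pos_of_pos hPpos _
      have T := tangent_aux (2 / q) α β m _ (by positivity) hα hβ hm hu
      rw [← Real.rpow_mul hPpos.le, show -(1 - γ) * -(2 / q) = γ by
        rw [hγ1, hγ]; field_simp, show (1 / (2 / q)) = q / 2 by field_simp] at T
      have hfu : f₁ y * P y ^ (-(1 - γ)) = r * ((f₁ y) ^ γ * (fp y) ^ (1 - γ)) := by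
        rw [hPy, Real.div_rpow (by positivity) hf.le, Real.mul_rpow hp0.le h.le,
          Real.rpow_neg hf.le, div_inv_eq_mul, ← hrdef]
        have : f₁ y ^ γ = f₁ y * f₁ y ^ (-(1 - γ)) := by
          nth_rw 2 [← Real.rpow_one (f₁ y)]
          rw [← Real.rpow_add h]; congr 1; ring
        rw [this]; ring
      have hPf : P y * fp y = p * f₁ y := by rw [hPy]; field_simp
      calc _ = (P y * fp y) * (α + β * (P y) ^ γ) ^ (-(q / 2)) := by ring
        _ ≤ (p * f₁ y) * (E / (α + β * M) * (α + β * M * (P y ^ (-(1 - γ)) / m))) := by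
          rw [hPf]; exact mul_le_mul_of_nonneg_left T (by positivity)
        _ = c * α * f₁ y + c * β * M / m * (f₁ y * P y ^ (-(1 - γ))) := by rw [hc]; ring
        _ = _ := by rw [hfu]; ring
  calc _ ≤ ∫ y, (c * α * f₁ y + c * β * M / m * r * ((f₁ y) ^ γ * (fp y) ^ (1 - γ))) := by
        refine integral_mono_of_nonneg (Filter.Eventually.of_forall fun y => ?_)
          ((I1.const_mul _).add (IC.const_mul _)) (Filter.Eventually.of_forall key)
        have a := hP0 y
        have b := hfp0 y
        have d := Real.rpow_nonneg a γ
        simp only [Pi.zero_apply]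
        positivity
    _ = c * α + c * β * M / m * (r * Cp) := by
        rw [integral_add (I1.const_mul _) (IC.const_mul _), integral_const_mul,
          integral_const_mul, hi₁, ← hCp]; ring
    _ = p * E := by
        rw [← hmdef, hc]; field_simp
end

section
/- For every q > 0 and c > 0, the function g defined on [0, ∞) by g(k) = k / (1 + c/k)^{q/2} for k > 0 (equivalently g(k) = k^{1+q/2}/(k+c)^{q/2}) and g(0) = 0 is convex on [0, ∞). -/
/-- The function `k ↦ k/(1 + c/k)^{q/2}` (with value `0` at `k = 0`) is convex on `[0, ∞)`. -/
theorem convex_oracle_cost (q c : ℝ) (hq : 0 < q) (hc : 0 < c)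
    (g : ℝ → ℝ) (hg : ∀ k : ℝ, 0 < k → g k = k / (1 + c / k) ^ (q / 2))
    (hg0 : g 0 = 0) :
    ConvexOn ℝ (Set.Ici (0 : ℝ)) g := by
  have key : ∀ k : ℝ, 0 ≤ k → g k = (k + c) * (k / (k + c)) ^ (1 + q / 2) := by
    intro k hk
    rcases hk.eq_or_lt with rfl | hk
    · rw [hg0, zero_div, Real.zero_rpow (by positivity), mul_zero]
    · have hkc : 0 < k + c := by positivity
      have h1 : 1 + c / k = (k / (k + c))⁻¹ := by field_simp
      have h2 : 0 < k / (k + c) := by positivity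
      rw [hg k hk, h1, Real.inv_rpow h2.le, Real.rpow_add h2, Real.rpow_one, div_inv_eq_mul]
      field_simp
  refine ⟨convex_Ici 0, ?_⟩
  intro x hx y hy a b ha hb hab
  have hx : 0 ≤ x := hx
  have hy : 0 ≤ y := hy
  simp only [smul_eq_mul]
  have hxc : 0 < x + c := by positivity
  have hyc : 0 < y + c := by positivity
  have hz : 0 ≤ a * x + b * y := by positivity
  have hB : 0 < a * x + b * y + c := by positivity
  have hBe : a * x + b * y + c = a * (x + c) + b * (y + c) := by linear_combination (-c) * hab
  rw [key x hx, key y hy, key _ hz]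
  have hx' : x / (x + c) ∈ Set.Ici (0 : ℝ) := Set.mem_Ici.2 (by positivity)
  have hy' : y / (y + c) ∈ Set.Ici (0 : ℝ) := Set.mem_Ici.2 (by positivity)
  have hw1 : 0 ≤ a * (x + c) / (a * x + b * y + c) := by positivity
  have hw2 : 0 ≤ b * (y + c) / (a * x + b * y + c) := by positivity
  have hw : a * (x + c) / (a * x + b * y + c) + b * (y + c) / (a * x + b * y + c) = 1 := by
    rw [← add_div, ← hBe, div_self hB.ne']
  have hJ := (convexOn_rpow (p := 1 + q / 2) (by linarith)).2 hx' hy' hw1 hw2 hw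
  simp only [smul_eq_mul] at hJ
  have e : a * (x + c) / (a * x + b * y + c) * (x / (x + c)) +
      b * (y + c) / (a * x + b * y + c) * (y / (y + c)) =
      (a * x + b * y) / (a * x + b * y + c) := by
    field_simp
  rw [e] at hJ
  refine (mul_le_mul_of_nonneg_left hJ hB.le).trans_eq ?_
  generalize (x / (x + c)) ^ (1 + q / 2) = X
  generalize (y / (y + c)) ^ (1 + q / 2) = Y
  field_simp
end

section
/- Let N ≥ 1 be an integer, p ∈ (0,1), q > 0, and r > 0, and let K be a binomial random variable with parameters N and p. Then E[ K / (1 + rN/K)^{q/2} ] ≥ N p / (1 + r/p)^{q/2}, where the summand corresponding to K = 0 is taken to be 0. -/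
open Finset

lemma aux_sum1 (N : ℕ) (p : ℝ) :
    ∑ k ∈ Finset.range (N + 1), (N.choose k : ℝ) * p ^ k * (1 - p) ^ (N - k) = 1 := by
  have h := congrArg (Polynomial.eval p) (bernsteinPolynomial.sum ℝ N)
  simpa [Polynomial.eval_finset_sum, bernsteinPolynomial] using h

lemma aux_sumk (N : ℕ) (p : ℝ) :
    ∑ k ∈ Finset.range (N + 1), (N.choose k : ℝ) * p ^ k * (1 - p) ^ (N - k) * k = N * p := by
  have h := congrArg (Polynomial.eval p) (bernsteinPolynomial.sum_smul ℝ N)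
  simp [Polynomial.eval_finset_sum, bernsteinPolynomial] at h
  rw [← h]
  exact Finset.sum_congr rfl fun k _ => by ring

lemma aux_bern_s11 (a t s : ℝ) (ha : 0 < a) (ht : 0 < t) (hs : 0 < s) :
    (1 + a) * s ^ a * t - a * s ^ a * s ≤ t ^ a * t := by
  have h := one_add_mul_self_le_rpow_one_add (s := t / s - 1) (p := 1 + a)
    (by have := div_pos ht hs; linarith) (by linarith)
  rw [show 1 + (t / s - 1) = t / s by ring, Real.div_rpow ht.le hs.le,
    add_comm 1 a, Real.rpow_add_one ht.ne', Real.rpow_add_one hs.ne'] at h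
  have hsa : 0 < s ^ a := Real.rpow_pos_of_pos hs a
  rw [le_div_iff₀ (by positivity)] at h
  refine le_trans (le_of_eq ?_) h
  field_simp
  ring

lemma aux_inv (a u c : ℝ) (hu : 0 < u) (hc : 0 < c) :
    u / (1 + c / u) ^ a = u * (u / (u + c)) ^ a := by
  rw [show u / (u + c) = (1 + c / u)⁻¹ by field_simp, Real.inv_rpow (by positivity)]
  rfl

/-- Jensen lower bound on the oracle expectation for a binomial random variable. -/
theorem binomial_oracle_expectation_lower_bound (N : ℕ) (hN : 1 ≤ N)
    (p q r : ℝ) (hp : p ∈ Set.Ioo (0 : ℝ) 1) (hq : 0 < q) (hr : 0 < r) :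
    (N : ℝ) * p / (1 + r / p) ^ (q / 2)
      ≤ ∑ k ∈ Finset.range (N + 1),
          (N.choose k : ℝ) * p ^ k * (1 - p) ^ (N - k) *
            (if k = 0 then 0 else (k : ℝ) / (1 + r * N / k) ^ (q / 2)) := by
  obtain ⟨hp0, hp1⟩ := hp
  have hN' : (0 : ℝ) < N := by exact_mod_cast hN
  have ha : 0 < q / 2 := by positivity
  generalize q / 2 = a at ha ⊢
  have hs : 0 < p / (p + r) := by positivity
  have hsp : p / (p + r) * (p + r) = p := by field_simp
  rw [mul_div_assoc, aux_inv a p r hp0 hr]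
  generalize p / (p + r) = s at hs hsp ⊢
  have hsa : 0 < s ^ a := Real.rpow_pos_of_pos hs a
  have key : ∀ k : ℕ, (1 + a) * s ^ a * k - a * s ^ a * s * (k + r * N) ≤
      (if k = 0 then 0 else (k : ℝ) / (1 + r * N / k) ^ a) := by
    intro k
    split_ifs with h
    · subst h
      have : 0 ≤ a * s ^ a * s * (r * N) := by positivity
      simpa using this
    · have hk : (0 : ℝ) < k := by exact_mod_cast Nat.pos_of_ne_zero h
      have hc : 0 < r * N := by positivity
      rw [aux_inv a k _ hk hc]
      have hv : 0 < (k : ℝ) + r * N := by positivity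
      have hb := aux_bern_s11 a (k / (k + r * N)) s ha (by positivity) hs
      have hkv : (k : ℝ) / (k + r * N) * (k + r * N) = k := by field_simp
      generalize (k : ℝ) / (k + r * N) = t at hb hkv ⊢
      have := mul_le_mul_of_nonneg_right hb hv.le
      have e : (k : ℝ) * t ^ a = t ^ a * t * (k + r * N) := by
        rw [mul_assoc, hkv, mul_comm]
      rw [e]
      refine le_trans (le_of_eq ?_) this
      linear_combination (-(1 + a) * s ^ a) * hkv
  calc (N : ℝ) * (p * s ^ a)
      = ∑ k ∈ Finset.range (N + 1), (N.choose k : ℝ) * p ^ k * (1 - p) ^ (N - k) *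
          ((1 + a) * s ^ a * k - a * s ^ a * s * (k + r * N)) := by
        have : ∀ k : ℕ, (N.choose k : ℝ) * p ^ k * (1 - p) ^ (N - k) *
          ((1 + a) * s ^ a * k - a * s ^ a * s * (k + r * N)) =
          ((1 + a) * s ^ a - a * s ^ a * s) * ((N.choose k : ℝ) * p ^ k * (1 - p) ^ (N - k) * k)
          - a * s ^ a * s * r * N * ((N.choose k : ℝ) * p ^ k * (1 - p) ^ (N - k)) := by
          intro k; ring
        simp_rw [this]
        rw [Finset.sum_sub_distrib, ← Finset.mul_sum, ← Finset.mul_sum, aux_sum1, aux_sumk]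
        linear_combination (a * s ^ a * N) * hsp
    _ ≤ _ := by
        refine Finset.sum_le_sum fun k _ => mul_le_mul_of_nonneg_left (key k) ?_
        have : 0 < 1 - p := by linarith
        positivity
end

section
/- Fix μ ∈ ℝ, σ > 0, p ∈ (0,1) and γ ∈ (0,1), and for t > 0 let C_p^γ(t) denote the Chernoff coefficient of the t-parametrized Gaussian model. Then limsup_{t → ∞} t^{γ/2} ( C_p^γ(t) − p^{1−γ} ) ≤ (1−p)^{1−γ} · e^{−γ s/2} / √(1−γ), where s = μ²/σ². -/
open MeasureTheory Real Filter

noncomputable def auxA (γ x : ℝ) : ℝ := γ * x / (1 + x) + (1 - γ)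

noncomputable def auxG (γ s x : ℝ) : ℝ :=
  (1 + x) ^ (-(γ / 2)) * (auxA γ x) ^ (-(1 / 2 : ℝ)) *
    Real.exp (-(γ * (1 - γ) / (1 + x) / auxA γ x * (s / 2)))

lemma auxA_pos {γ x : ℝ} (h0 : 0 < γ) (h1 : γ < 1) (hx : 0 ≤ x) : 0 < auxA γ x := by
  unfold auxA
  have : 0 ≤ γ * x / (1 + x) := by positivity
  linarith

lemma gaussPdf_rpow (m v y r : ℝ) (hv : 0 < v) :
    gaussPdf m v y ^ r = (2 * π * v) ^ (-(r / 2)) * Real.exp (-(r * (y - m) ^ 2 / (2 * v))) := by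
  have hw : 0 < 2 * π * v := by positivity
  unfold gaussPdf
  rw [Real.sqrt_eq_rpow, div_eq_mul_inv, ← Real.rpow_neg hw.le,
    Real.mul_rpow (Real.exp_pos _).le (by positivity), ← Real.rpow_mul hw.le, ← Real.exp_mul,
    mul_comm]
  congr 2 <;> ring

lemma gaussPdf_nonneg (m v y : ℝ) : 0 ≤ gaussPdf m v y := by
  unfold gaussPdf; positivity

lemma gaussPdf_integral (m v : ℝ) (hv : 0 < v) :
    Integrable (gaussPdf m v) ∧ ∫ y, gaussPdf m v y = 1 := by
  have he : gaussPdf m v = ProbabilityTheory.gaussianPDFReal m ⟨v, hv.le⟩ := by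
    funext y
    simp only [gaussPdf, ProbabilityTheory.gaussianPDFReal]
    rw [div_eq_mul_inv, mul_comm]
    rfl
  rw [he]
  refine ⟨ProbabilityTheory.integrable_gaussianPDFReal _ _,
    ProbabilityTheory.integral_gaussianPDFReal_eq_one _ ?_⟩
  intro h
  have := congrArg NNReal.toReal h
  simp at this
  exact hv.ne' this

lemma cross (μ σ γ t : ℝ) (hσ : 0 < σ) (h0 : 0 < γ) (h1 : γ < 1) (ht : 0 < t) :
    Integrable (fun y => (gaussPdf μ (σ ^ 2 * (1 + 1 / t)) y) ^ γ *
      (gaussPdf 0 (σ ^ 2 / t) y) ^ (1 - γ)) ∧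
    t ^ (γ / 2) * ∫ y, (gaussPdf μ (σ ^ 2 * (1 + 1 / t)) y) ^ γ *
      (gaussPdf 0 (σ ^ 2 / t) y) ^ (1 - γ) = auxG γ (μ ^ 2 / σ ^ 2) t⁻¹ := by
  have hA := auxA_pos h0 h1 (inv_pos.2 ht).le
  have hx : 0 < 1 + t⁻¹ := by positivity
  set A := auxA γ t⁻¹ with hAdef
  have hAeq : A * (t + 1) = γ + (1 - γ) * (t + 1) := by
    rw [hAdef]; unfold auxA; field_simp
  set B := t * A / (2 * σ ^ 2) with hB
  have hBpos : 0 < B := by positivity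
  set c := γ * μ / ((t + 1) * A) with hc
  set K := (2 * π * (σ ^ 2 * (1 + t⁻¹))) ^ (-(γ / 2)) * (2 * π * (σ ^ 2 / t)) ^ (-((1 - γ) / 2))
    with hK
  set E := Real.exp (-(γ * (1 - γ) / (1 + t⁻¹) / A * (μ ^ 2 / σ ^ 2 / 2))) with hE
  have key : ∀ y, (gaussPdf μ (σ ^ 2 * (1 + 1 / t)) y) ^ γ *
      (gaussPdf 0 (σ ^ 2 / t) y) ^ (1 - γ) = K * E * Real.exp (-B * (y - c) ^ 2) := by
    intro y
    rw [gaussPdf_rpow _ _ _ _ (by positivity), gaussPdf_rpow _ _ _ _ (by positivity), one_div]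
    rw [hK, hE, mul_mul_mul_comm, ← Real.exp_add, mul_assoc _ (Real.exp _), ← Real.exp_add]
    congr 2
    rw [hB, hc]
    have hA2 : A = (γ + (1 - γ) * (t + 1)) / (t + 1) := by
      rw [← hAeq]; field_simp
    have hpos : 0 < γ + (1 - γ) * (t + 1) := by rw [← hAeq]; positivity
    rw [hA2]
    have hne := hpos.ne'
    obtain ⟨D, hD⟩ : ∃ D, D = γ + (1 - γ) * (t + 1) := ⟨_, rfl⟩
    rw [← hD] at hne ⊢
    field_simp
    rw [hD]
    ring
  have hi : Integrable (fun y : ℝ => Real.exp (-B * (y - c) ^ 2)) :=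
    (integrable_exp_neg_mul_sq hBpos).comp_sub_right c
  simp_rw [key]
  refine ⟨hi.const_mul _, ?_⟩
  rw [integral_const_mul, integral_sub_right_eq_self (fun y : ℝ => Real.exp (-B * y ^ 2)) c,
    integral_gaussian]
  unfold auxG
  rw [← hAdef, ← hE]
  have : t ^ (γ / 2) * (K * √(π / B)) = (1 + t⁻¹) ^ (-(γ / 2)) * A ^ (-(1 / 2 : ℝ)) := by
    have e1 : π / B = (2 * π * σ ^ 2) / (t * A) := by rw [hB]; field_simp
    have e2 : 2 * π * (σ ^ 2 * (1 + t⁻¹)) = (2 * π * σ ^ 2) * (1 + t⁻¹) := by ring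
    have e3 : 2 * π * (σ ^ 2 / t) = (2 * π * σ ^ 2) / t := by ring
    have hw : 0 < 2 * π * σ ^ 2 := by positivity
    rw [e1, hK, e2, e3]
    generalize 2 * π * σ ^ 2 = w at hw
    generalize 1 + t⁻¹ = z at hx
    rw [Real.sqrt_eq_rpow]
    rw [Real.rpow_def_of_pos ht, Real.rpow_def_of_pos (by positivity),
      Real.rpow_def_of_pos (by positivity), Real.rpow_def_of_pos (by positivity),
      Real.rpow_def_of_pos hx, Real.rpow_def_of_pos hA]
    simp only [← Real.exp_add]
    rw [Real.log_mul hw.ne' hx.ne', Real.log_div hw.ne' ht.ne', Real.log_div hw.ne' (by positivity),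
      Real.log_mul ht.ne' hA.ne']
    congr 1
    ring
  rw [← this]; ring

lemma auxG_tendsto (γ s : ℝ) (h1 : γ < 1) :
    Tendsto (fun t : ℝ => auxG γ s t⁻¹) atTop
      (nhds (Real.exp (-γ * s / 2) / Real.sqrt (1 - γ))) := by
  have h : (0:ℝ) < 1 - γ := by linarith
  have hv : auxG γ s 0 = Real.exp (-γ * s / 2) / Real.sqrt (1 - γ) := by
    have : auxA γ 0 = 1 - γ := by simp [auxA]
    unfold auxG
    rw [this, Real.sqrt_eq_rpow, Real.rpow_neg h.le, add_zero, Real.one_rpow, one_mul]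
    have e : -(γ * (1 - γ) / 1 / (1 - γ) * (s / 2)) = -γ * s / 2 := by field_simp
    rw [e, mul_comm]
    rfl
  rw [← hv]
  have hA : ContinuousAt (auxA γ) 0 := by
    unfold auxA
    refine ContinuousAt.add (ContinuousAt.div (by fun_prop) (by fun_prop) (by simp)) (by fun_prop)
  have hA0 : auxA γ 0 ≠ 0 := by simp [auxA]; linarith
  have hG : ContinuousAt (auxG γ s) 0 := by
    unfold auxG
    refine ContinuousAt.mul (ContinuousAt.mul ?_ ?_) ?_
    · exact ContinuousAt.rpow_const (by fun_prop) (Or.inl (by simp))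
    · exact ContinuousAt.rpow_const hA (Or.inl hA0)
    · refine Real.continuous_exp.continuousAt.comp (f := fun x => -(γ * (1 - γ) / (1 + x) / auxA γ x * (s / 2))) ?_
      refine ContinuousAt.neg (ContinuousAt.mul (ContinuousAt.div (ContinuousAt.div (by fun_prop) (by fun_prop) (by simp)) hA hA0) (by fun_prop))
  exact hG.tendsto.comp tendsto_inv_atTop_zero

/-- High-SNR limsup bound on the Chernoff coefficient `C_p^γ(t)` (Lemma 3). -/
theorem chernoff_high_snr_limsup (μ σ p γ : ℝ) (hσ : 0 < σ)
    (hp : p ∈ Set.Ioo (0 : ℝ) 1) (hγ : γ ∈ Set.Ioo (0 : ℝ) 1)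
    (s : ℝ) (hs : s = μ ^ 2 / σ ^ 2)
    (Cp : ℝ → ℝ)
    (hCp : ∀ t : ℝ, Cp t = ∫ y : ℝ,
      (gaussPdf μ (σ ^ 2 * (1 + 1 / t)) y) ^ γ *
        (p * gaussPdf μ (σ ^ 2 * (1 + 1 / t)) y
          + (1 - p) * gaussPdf 0 (σ ^ 2 / t) y) ^ (1 - γ)) :
    Filter.limsup (fun t : ℝ => t ^ (γ / 2) * (Cp t - p ^ (1 - γ))) Filter.atTop
      ≤ (1 - p) ^ (1 - γ) * Real.exp (-γ * s / 2) / Real.sqrt (1 - γ) := by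
  obtain ⟨hp0, hp1⟩ := hp
  obtain ⟨h0, h1⟩ := hγ
  have hq : 0 < 1 - p := by linarith
  have bound : ∀ t : ℝ, 0 < t → t ^ (γ / 2) * (Cp t - p ^ (1 - γ)) ≤
      (1 - p) ^ (1 - γ) * auxG γ s t⁻¹ := by
    intro t ht
    obtain ⟨hi, he⟩ := cross μ σ γ t hσ h0 h1 ht
    obtain ⟨hi1, he1⟩ := gaussPdf_integral μ (σ ^ 2 * (1 + 1 / t)) (by positivity)
    rw [hs, ← he]
    have : Cp t ≤ p ^ (1 - γ) * (∫ y, gaussPdf μ (σ ^ 2 * (1 + 1 / t)) y) + (1 - p) ^ (1 - γ) * ∫ y, (gaussPdf μ (σ ^ 2 * (1 + 1 / t)) y) ^ γ *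
        (gaussPdf 0 (σ ^ 2 / t) y) ^ (1 - γ) := by
      rw [hCp, ← integral_const_mul, ← integral_const_mul,
        ← integral_add (hi1.const_mul _) (hi.const_mul _)]
      refine integral_mono_of_nonneg (Eventually.of_forall fun y => ?_)
        ((hi1.const_mul _).add (hi.const_mul _)) (Eventually.of_forall fun y => ?_)
      · have g1 := gaussPdf_nonneg μ (σ ^ 2 * (1 + 1 / t)) y
        have g0 := gaussPdf_nonneg 0 (σ ^ 2 / t) y
        simp only [Pi.zero_apply]
        positivity
      · have g1 := gaussPdf_nonneg μ (σ ^ 2 * (1 + 1 / t)) y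
        have g0 := gaussPdf_nonneg 0 (σ ^ 2 / t) y
        simp only []
        generalize gaussPdf μ (σ ^ 2 * (1 + 1 / t)) y = f at *
        generalize gaussPdf 0 (σ ^ 2 / t) y = g at *
        have hsub := Real.rpow_add_le_add_rpow (mul_nonneg hp0.le g1) (mul_nonneg hq.le g0)
          (by linarith : 0 ≤ 1 - γ) (by linarith : 1 - γ ≤ 1)
        rw [Real.mul_rpow hp0.le g1, Real.mul_rpow hq.le g0] at hsub
        have hf : f ^ γ * f ^ (1 - γ) = f := by
          rw [← Real.rpow_add_of_nonneg g1 h0.le (by linarith)]; simp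
        calc f ^ γ * (p * f + (1 - p) * g) ^ (1 - γ)
            ≤ f ^ γ * (p ^ (1 - γ) * f ^ (1 - γ) + (1 - p) ^ (1 - γ) * g ^ (1 - γ)) :=
              mul_le_mul_of_nonneg_left hsub (by positivity)
          _ = p ^ (1 - γ) * (f ^ γ * f ^ (1 - γ)) + (1 - p) ^ (1 - γ) * (f ^ γ * g ^ (1 - γ)) := by
              ring
          _ = _ := by rw [hf]
    rw [he1] at this
    calc _ ≤ t ^ (γ / 2) * ((1 - p) ^ (1 - γ) * ∫ y, (gaussPdf μ (σ ^ 2 * (1 + 1 / t)) y) ^ γ *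
        (gaussPdf 0 (σ ^ 2 / t) y) ^ (1 - γ)) :=
          mul_le_mul_of_nonneg_left (by linarith) (by positivity)
      _ = _ := by ring
  have hlim := (auxG_tendsto γ s h1).const_mul ((1 - p) ^ (1 - γ))
  rw [← mul_div_assoc] at hlim
  rw [Filter.limsup_eq]
  have hR : 0 ≤ (1 - p) ^ (1 - γ) * Real.exp (-γ * s / 2) / Real.sqrt (1 - γ) := by positivity
  by_cases hb : BddBelow {a | ∀ᶠ t in atTop, t ^ (γ / 2) * (Cp t - p ^ (1 - γ)) ≤ a}
  · refine le_of_forall_pos_le_add fun ε hε => csInf_le hb ?_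
    filter_upwards [hlim.eventually_le_const (lt_add_of_pos_right _ hε), eventually_gt_atTop 0]
      with t h ht
    exact (bound t ht).trans h
  · rw [Real.sInf_of_not_bddBelow hb]; exact hR
end

section
/- Fix μ ∈ ℝ, σ > 0 and γ ∈ (0,1). Then lim_{t → ∞} t^{γ/2} · C₀^γ(t) = e^{−γ s/2} / √(1−γ), where C₀^γ(t) = ∫_ℝ f₁ᵗ(y)^γ f₀ᵗ(y)^{1−γ} dy and s = μ²/σ². -/
open MeasureTheory Real Filter

lemma closed_form (μ σ γ t : ℝ) (hσ : 0 < σ) (h0 : 0 < γ) (h1 : γ < 1) (ht : 0 < t) :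
    t ^ (γ / 2) * ∫ y : ℝ,
      (gaussPdf μ (σ ^ 2 * (1 + 1 / t)) y) ^ γ * (gaussPdf 0 (σ ^ 2 / t) y) ^ (1 - γ) =
    (√(1 / (1 + t⁻¹))) ^ γ * √((1 + t⁻¹) / (t⁻¹ + (1 - γ))) *
      Real.exp (-(μ ^ 2 * γ * (1 - γ)) / (2 * σ ^ 2 * (t⁻¹ + (1 - γ)))) := by
  have h1' : 0 < 1 - γ := by linarith
  have hD : 0 < 1 + (1 - γ) * t := by positivity
  set P : ℝ := √(2 * π * (σ ^ 2 / t)) with hP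
  have hPpos : 0 < P := Real.sqrt_pos.2 (by positivity)
  have hQpos : 0 < √(1 + t) := Real.sqrt_pos.2 (by positivity)
  have hA : √(2 * π * (σ ^ 2 * (1 + 1 / t))) = P * √(1 + t) := by
    rw [hP, ← Real.sqrt_mul (by positivity)]
    congr 1
    field_simp
    ring
  set B : ℝ := t * (1 + (1 - γ) * t) / (2 * σ ^ 2 * (t + 1)) with hB
  have hBpos : 0 < B := by positivity
  set m : ℝ := γ * μ / (1 + (1 - γ) * t) with hm
  set F : ℝ := Real.exp (-(μ ^ 2 * γ * (1 - γ)) / (2 * σ ^ 2 * (t⁻¹ + (1 - γ)))) with hF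
  have hint : ∀ y : ℝ, (gaussPdf μ (σ ^ 2 * (1 + 1 / t)) y) ^ γ *
      (gaussPdf 0 (σ ^ 2 / t) y) ^ (1 - γ) =
      (F / (P * √(1 + t) ^ γ)) * Real.exp (-B * (y - m) ^ 2) := by
    intro y
    unfold gaussPdf
    rw [hA, ← hP, Real.div_rpow (Real.exp_pos _).le (by positivity),
      Real.div_rpow (Real.exp_pos _).le hPpos.le, ← Real.exp_mul, ← Real.exp_mul,
      Real.mul_rpow hPpos.le hQpos.le, div_mul_div_comm, ← Real.exp_add, div_mul_eq_mul_div F, hF,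
      ← Real.exp_add]
    have e : P ^ γ * √(1 + t) ^ γ * P ^ (1 - γ) = P * √(1 + t) ^ γ := by
      have : P ^ γ * P ^ (1 - γ) = P := by
        rw [← Real.rpow_add hPpos]; simp
      calc _ = (P ^ γ * P ^ (1 - γ)) * √(1 + t) ^ γ := by ring
        _ = _ := by rw [this]
    rw [e]
    congr 2
    have hinv : t⁻¹ + (1 - γ) = (1 + (1 - γ) * t) / t := by field_simp
    have hinv2 : 1 + 1 / t = (t + 1) / t := by field_simp
    rw [hinv, hinv2, hB, hm]
    have hD' := hD.ne'
    generalize hDD : 1 + (1 - γ) * t = D at *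
    have ht1 : t + 1 ≠ 0 := by positivity
    field_simp
    subst hDD
    ring
  simp_rw [hint]
  rw [integral_const_mul, integral_sub_right_eq_self (fun y => Real.exp (-B * y ^ 2)) m,
    integral_gaussian]
  have h2 : t ^ (γ / 2) = √t ^ γ := by
    rw [Real.sqrt_eq_rpow, ← Real.rpow_mul ht.le]; congr 1; ring
  have h3 : √(1 / (1 + t⁻¹)) ^ γ = √t ^ γ / √(1 + t) ^ γ := by
    rw [← Real.div_rpow (by positivity) (by positivity), ← Real.sqrt_div ht.le]
    congr 2
    field_simp
    try ring
  have h4 : √((1 + t⁻¹) / (t⁻¹ + (1 - γ))) = √(π / B) / P := by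
    rw [hP, ← Real.sqrt_div (by positivity)]
    congr 1
    have hinv : t⁻¹ + (1 - γ) = (1 + (1 - γ) * t) / t := by field_simp
    have hinv2 : 1 + t⁻¹ = (t + 1) / t := by field_simp
    rw [hinv, hinv2, hB]
    have hD' := hD.ne'
    generalize hDD : 1 + (1 - γ) * t = D at *
    have ht1 : t + 1 ≠ 0 := by positivity
    field_simp
  rw [h2, h3, h4]
  field_simp

/-- Asymptotics of `C₀^γ(t)` as `t → ∞`:  `t^{γ/2} C₀^γ(t) → e^{−γs/2}/√(1−γ)`. -/
theorem chernoff_C0_high_snr_limit (μ σ γ : ℝ) (hσ : 0 < σ) (hγ : γ ∈ Set.Ioo (0 : ℝ) 1)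
    (s : ℝ) (hs : s = μ ^ 2 / σ ^ 2)
    (C0 : ℝ → ℝ)
    (hC0 : ∀ t : ℝ, C0 t = ∫ y : ℝ,
      (gaussPdf μ (σ ^ 2 * (1 + 1 / t)) y) ^ γ * (gaussPdf 0 (σ ^ 2 / t) y) ^ (1 - γ)) :
    Filter.Tendsto (fun t : ℝ => t ^ (γ / 2) * C0 t) Filter.atTop
      (nhds (Real.exp (-γ * s / 2) / Real.sqrt (1 - γ))) := by
  obtain ⟨h0, h1⟩ := hγ
  have h1' : 0 < 1 - γ := by linarith
  have hc : ContinuousAt (fun u : ℝ => (√(1 / (1 + u))) ^ γ * √((1 + u) / (u + (1 - γ))) *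
      Real.exp (-(μ ^ 2 * γ * (1 - γ)) / (2 * σ ^ 2 * (u + (1 - γ))))) 0 := by
    have n1 : (1 : ℝ) + 0 ≠ 0 := by norm_num
    have n2 : 0 + (1 - γ) ≠ 0 := by simpa using h1'.ne'
    have n3 : 2 * σ ^ 2 * (0 + (1 - γ)) ≠ 0 := by positivity
    refine ContinuousAt.mul (ContinuousAt.mul (ContinuousAt.rpow_const ?_ (Or.inr h0.le)) ?_) ?_
    · refine ContinuousAt.sqrt ?_
      refine ContinuousAt.div ?_ ?_ n1
      all_goals fun_prop
    · refine ContinuousAt.sqrt ?_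
      refine ContinuousAt.div ?_ ?_ n2
      all_goals fun_prop
    · refine ContinuousAt.rexp ?_
      refine ContinuousAt.div ?_ ?_ n3
      all_goals fun_prop
  have hl := hc.tendsto.comp (tendsto_inv_atTop_zero (𝕜 := ℝ))
  have hv : (√(1 / (1 + (0 : ℝ)))) ^ γ * √((1 + 0) / (0 + (1 - γ))) *
      Real.exp (-(μ ^ 2 * γ * (1 - γ)) / (2 * σ ^ 2 * (0 + (1 - γ)))) =
      Real.exp (-γ * s / 2) / Real.sqrt (1 - γ) := by
    have e : -(μ ^ 2 * γ * (1 - γ)) / (2 * σ ^ 2 * (0 + (1 - γ))) = -γ * s / 2 := by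
      rw [hs, zero_add]; field_simp
    rw [e]
    simp
    ring
  rw [hv] at hl
  refine hl.congr' ?_
  filter_upwards [eventually_gt_atTop 0] with t ht
  rw [hC0, closed_form μ σ γ t hσ h0 h1 ht]
  rfl
end

section
/- Fix μ ∈ ℝ, σ > 0 and γ ∈ (0,1). Then lim_{t → 0⁺} ( ( C₀^γ(t) )^{−1/(1−γ)} − 1 ) / t = γ s / 2, where C₀^γ(t) = ∫_ℝ f₁ᵗ(y)^γ f₀ᵗ(y)^{1−γ} dy and s = μ²/σ². -/
open MeasureTheory Real Filter

lemma aux_pdf (m v y : ℝ) (hv : 0 < v) :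
    gaussPdf m v y = Real.exp (-(y - m) ^ 2 / (2 * v) - Real.log (2 * Real.pi * v) / 2) := by
  have h : 0 < 2 * Real.pi * v := by positivity
  rw [gaussPdf, Real.exp_sub, Real.exp_half, Real.exp_log h]

lemma aux_int (c d K : ℝ) (hc : 0 < c) :
    ∫ y : ℝ, Real.exp (-c * (y - d) ^ 2 + K) = Real.exp (K + Real.log (Real.pi / c) / 2) := by
  have h : 0 < Real.pi / c := by positivity
  simp_rw [Real.exp_add]
  rw [MeasureTheory.integral_mul_const,
    MeasureTheory.integral_sub_right_eq_self (fun y : ℝ => Real.exp (-c * y ^ 2)) d,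
    integral_gaussian, Real.exp_half, Real.exp_log h, mul_comm]

noncomputable def auxL (γ s t : ℝ) : ℝ :=
  -(Real.log (1 + t) / 2) + Real.log (1 + (1 - γ) * t) / (2 * (1 - γ))
    + γ * s * t / (2 * (1 + (1 - γ) * t))

lemma aux_C (μ σ γ t : ℝ) (hσ : 0 < σ) (h0 : 0 < γ) (h1 : γ < 1) (ht : 0 < t) :
    (∫ y : ℝ, (gaussPdf μ (σ ^ 2 * (1 + 1 / t)) y) ^ γ *
      (gaussPdf 0 (σ ^ 2 / t) y) ^ (1 - γ)) =
      Real.exp (-(1 - γ) * auxL γ (μ ^ 2 / σ ^ 2) t) := by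
  have hg : 0 < 1 - γ := by linarith
  have hD : 0 < 1 + (1 - γ) * t := by positivity
  have hT : 0 < 1 + t := by positivity
  have hv1 : 0 < σ ^ 2 * (1 + 1 / t) := by positivity
  have hv0 : 0 < σ ^ 2 / t := by positivity
  have hpi := Real.pi_pos
  have key : ∀ y : ℝ, (gaussPdf μ (σ ^ 2 * (1 + 1 / t)) y) ^ γ *
      (gaussPdf 0 (σ ^ 2 / t) y) ^ (1 - γ) =
      Real.exp (-(t * (1 + (1 - γ) * t) / (2 * σ ^ 2 * (1 + t))) *
          (y - γ * μ / (1 + (1 - γ) * t)) ^ 2 +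
        (-(γ * (1 - γ) * t * μ ^ 2 / (2 * σ ^ 2 * (1 + (1 - γ) * t)))
          - γ * (Real.log (2 * Real.pi * (σ ^ 2 * (1 + 1 / t))) / 2)
          - (1 - γ) * (Real.log (2 * Real.pi * (σ ^ 2 / t)) / 2))) := by
    intro y
    rw [aux_pdf _ _ _ hv1, aux_pdf _ _ _ hv0, ← Real.exp_mul, ← Real.exp_mul, ← Real.exp_add]
    congr 1
    generalize Real.log (2 * Real.pi * (σ ^ 2 * (1 + 1 / t))) = A
    generalize Real.log (2 * Real.pi * (σ ^ 2 / t)) = B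
    have e1 : σ ^ 2 * (1 + 1 / t) = σ ^ 2 * (1 + t) / t := by field_simp; ring
    rw [e1]
    field_simp
    ring
  simp_rw [key]
  rw [aux_int _ _ _ (by positivity)]
  congr 1
  have l1 : Real.log (2 * Real.pi * (σ ^ 2 * (1 + 1 / t))) =
      Real.log (2 * Real.pi * (σ ^ 2 / t)) + Real.log (1 + t) := by
    rw [← Real.log_mul (by positivity) (by positivity)]
    congr 1
    field_simp
    ring
  have l2 : Real.log (Real.pi / (t * (1 + (1 - γ) * t) / (2 * σ ^ 2 * (1 + t)))) =
      Real.log (2 * Real.pi * (σ ^ 2 / t)) + Real.log (1 + t) - Real.log (1 + (1 - γ) * t) := by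
    rw [← Real.log_mul (by positivity) (by positivity),
      ← Real.log_div (by positivity) (by positivity)]
    congr 1
    field_simp
  rw [l1, l2, auxL]
  field_simp
  ring

lemma aux_deriv (γ s : ℝ) (h1 : γ < 1) :
    HasDerivAt (fun t => Real.exp (auxL γ s t)) (γ * s / 2) 0 := by
  have hg : 1 - γ ≠ 0 := by linarith
  have i1 : HasDerivAt (fun t : ℝ => 1 + t) 1 0 := (hasDerivAt_id 0).const_add 1
  have i2 : HasDerivAt (fun t : ℝ => 1 + (1 - γ) * t) ((1 - γ) * 1) 0 :=
    ((hasDerivAt_id (0 : ℝ)).const_mul (1 - γ)).const_add 1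
  have i3 : HasDerivAt (fun t : ℝ => γ * s * t) (γ * s * 1) 0 :=
    (hasDerivAt_id (0 : ℝ)).const_mul (γ * s)
  have d := ((((i1.log (by simp)).div_const 2).fun_neg.fun_add
    ((i2.log (by simp)).div_const (2 * (1 - γ)))).fun_add
    (i3.fun_div (i2.const_mul 2) (by simp))).exp
  refine HasDerivAt.congr_deriv d ?_
  simp
  field_simp
  ring

/-- Low-SNR asymptotics:  `((C₀^γ(t))^{−1/(1−γ)} − 1)/t → γs/2` as `t → 0⁺`. -/
theorem chernoff_C0_low_snr_limit (μ σ γ : ℝ) (hσ : 0 < σ) (hγ : γ ∈ Set.Ioo (0 : ℝ) 1)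
    (s : ℝ) (hs : s = μ ^ 2 / σ ^ 2)
    (C0 : ℝ → ℝ)
    (hC0 : ∀ t : ℝ, C0 t = ∫ y : ℝ,
      (gaussPdf μ (σ ^ 2 * (1 + 1 / t)) y) ^ γ * (gaussPdf 0 (σ ^ 2 / t) y) ^ (1 - γ)) :
    Filter.Tendsto (fun t : ℝ => ((C0 t) ^ (-(1 / (1 - γ))) - 1) / t)
      (nhdsWithin 0 (Set.Ioi (0 : ℝ))) (nhds (γ * s / 2)) := by
  subst hs
  obtain ⟨h0, h1⟩ := hγ
  have hg : 1 - γ ≠ 0 := by linarith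
  have d := (aux_deriv γ (μ ^ 2 / σ ^ 2) h1).tendsto_slope_zero_right
  refine d.congr' ?_
  filter_upwards [self_mem_nhdsWithin] with t ht
  rw [hC0 t, aux_C μ σ γ t hσ h0 h1 ht, ← Real.exp_mul]
  have e0 : auxL γ (μ ^ 2 / σ ^ 2) 0 = 0 := by simp [auxL]
  have e1 : -(1 - γ) * auxL γ (μ ^ 2 / σ ^ 2) t * -(1 / (1 - γ)) = auxL γ (μ ^ 2 / σ ^ 2) t := by
    field_simp
  rw [e1, zero_add, e0, Real.exp_zero, smul_eq_mul]
  field_simp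
end

section
/- Fix μ > 0, σ > 0, p ∈ (0,1) and t > 0, set s = μ²/σ² and η = log((1−p)/p), and assume 1 + (2η + log(1+t))/s > 0. Then the probability assigned by the Gaussian measure with mean μ and variance σ²(1 + 1/t) to the set 𝒴₁ = {y ∈ ℝ : p f₁(y) > (1−p) f₀(y)} equals Φ(z₁⁺) + Φ(z₁⁻), where z₁^± = √(s/t) ( ±√(1+t) − √(1 + (2η + log(1+t))/s) ) and Φ is the standard Gaussian cumulative distribution function. -/
open MeasureTheory Real

/-- Standard Gaussian cumulative distribution function. -/
noncomputable def stdNormCDF (z : ℝ) : ℝ := ∫ u in Set.Iic z, gaussPdf 0 1 u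

lemma gaussPdf_integrable_aux : Integrable (fun u => gaussPdf 0 1 u) := by
  have h := ProbabilityTheory.integrable_gaussianPDFReal 0 1
  refine h.congr (Filter.Eventually.of_forall fun u => ?_)
  simp [ProbabilityTheory.gaussianPDFReal, gaussPdf, div_eq_mul_inv, mul_comm]

lemma gaussPdf_Ioi_aux (a : ℝ) : ∫ u in Set.Ioi (-a), gaussPdf 0 1 u = stdNormCDF a := by
  rw [stdNormCDF, ← integral_comp_neg_Iic]
  simp [gaussPdf]

set_option maxHeartbeats 1000000 in
/-- The probability under `f₁` of the region `𝒴₁` in terms of the standard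
Gaussian CDF (formula for `ℙ₁(𝒴₁)`). -/
theorem prob_Y1_under_f1 (μ σ p t : ℝ) (hμ : 0 < μ) (hσ : 0 < σ)
    (hp : p ∈ Set.Ioo (0 : ℝ) 1) (ht : 0 < t)
    (s η : ℝ) (hs : s = μ ^ 2 / σ ^ 2) (hη : η = Real.log ((1 - p) / p))
    (hpos : 0 < 1 + (2 * η + Real.log (1 + t)) / s)
    (f₀ f₁ : ℝ → ℝ)
    (hf₀ : f₀ = fun y => gaussPdf 0 (σ ^ 2 / t) y)
    (hf₁ : f₁ = fun y => gaussPdf μ (σ ^ 2 * (1 + 1 / t)) y)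
    (z₁p z₁m : ℝ)
    (hz₁p : z₁p = Real.sqrt (s / t) *
      (Real.sqrt (1 + t) - Real.sqrt (1 + (2 * η + Real.log (1 + t)) / s)))
    (hz₁m : z₁m = Real.sqrt (s / t) *
      (-Real.sqrt (1 + t) - Real.sqrt (1 + (2 * η + Real.log (1 + t)) / s))) :
    (∫ y in {y : ℝ | p * f₁ y > (1 - p) * f₀ y}, f₁ y)
      = stdNormCDF z₁p + stdNormCDF z₁m := by
  obtain ⟨hp0, hp1⟩ := hp
  set q := Real.sqrt (1 + (2 * η + Real.log (1 + t)) / s) with hq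
  have hq0 : 0 < q := Real.sqrt_pos.2 hpos
  have hq2 : q ^ 2 = 1 + (2 * η + Real.log (1 + t)) / s := Real.sq_sqrt hpos.le
  set w := Real.sqrt (1 + t) with hw
  have hw0 : 0 < w := Real.sqrt_pos.2 (by linarith)
  have hw2 : w ^ 2 = 1 + t := Real.sq_sqrt (by linarith)
  obtain ⟨r, hr⟩ : ∃ r, r = Real.sqrt t := ⟨_, rfl⟩
  have hr0 : 0 < r := hr ▸ Real.sqrt_pos.2 ht
  have hr2 : r ^ 2 = t := hr ▸ Real.sq_sqrt ht.le
  obtain ⟨k, hk⟩ : ∃ k, k = μ / σ := ⟨_, rfl⟩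
  have hk0 : 0 < k := hk ▸ div_pos hμ hσ
  have hμk : μ = k * σ := by rw [hk]; field_simp
  have hsk : s = k ^ 2 := by rw [hs, hk, div_pow]
  have hst : Real.sqrt (s / t) = k / r := by
    rw [hsk, ← hr2, ← div_pow, Real.sqrt_sq (div_pos hk0 hr0).le]
  rw [hst] at hz₁p hz₁m
  have hL : 2 * η + Real.log (1 + t) = k ^ 2 * (q ^ 2 - 1) := by
    rw [hq2, hsk]; field_simp; ring
  have hwexp : w = Real.exp (Real.log (1 + t) / 2) := by
    rw [hw, Real.sqrt_eq_rpow, Real.rpow_def_of_pos (by linarith)]; ring_nf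
  have hpη : 1 - p = p * Real.exp η := by
    rw [hη, Real.exp_log (div_pos (by linarith) hp0)]; field_simp
  set D := Real.sqrt (2 * Real.pi * (σ ^ 2 / t)) with hD
  have hD0 : 0 < D := Real.sqrt_pos.2 (by positivity)
  obtain ⟨c, hc⟩ : ∃ c, c = σ * w / r := ⟨_, rfl⟩
  have hc0 : 0 < c := by rw [hc]; positivity
  have hv1 : σ ^ 2 * (1 + 1 / t) = c ^ 2 := by
    rw [hc, div_pow, mul_pow, hw2, hr2]; field_simp; ring
  have hD1 : Real.sqrt (2 * Real.pi * (σ ^ 2 * (1 + 1 / t))) = w * D := by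
    rw [hw, hD, ← Real.sqrt_mul (by linarith)]; congr 1; field_simp; ring
  have hD2 : Real.sqrt (2 * Real.pi * (σ ^ 2 * (1 + 1 / t))) = Real.sqrt (2 * Real.pi) * c := by
    rw [hv1, Real.sqrt_mul (by positivity), Real.sqrt_sq hc0.le]
  have hf1u : ∀ u, f₁ (μ + c * u) = c⁻¹ * gaussPdf 0 1 u := by
    intro u
    rw [hf₁]
    simp only [gaussPdf]
    rw [hD2, hv1]
    have : -(μ + c * u - μ) ^ 2 / (2 * c ^ 2) = -(u - 0) ^ 2 / (2 * 1) := by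
      field_simp; ring
    rw [this, mul_one]; field_simp
  have hf1u' : ∀ u, f₁ (μ + c * u) = Real.exp (-u ^ 2 / 2) / (w * D) := by
    intro u
    rw [hf₁]
    simp only [gaussPdf]
    rw [hD1, hv1]
    have : -(μ + c * u - μ) ^ 2 / (2 * c ^ 2) = -u ^ 2 / 2 := by
      field_simp; ring
    rw [this]
  have hf0u : ∀ u, f₀ (μ + c * u) = Real.exp (-(k * r + w * u) ^ 2 / 2) / D := by
    intro u
    rw [hf₀]
    simp only [gaussPdf]
    rw [← hD]
    have : -(μ + c * u - 0) ^ 2 / (2 * (σ ^ 2 / t)) = -(k * r + w * u) ^ 2 / 2 := by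
      rw [hc, hμk, ← hr2]; field_simp; ring
    rw [this]
  have hset : ∀ u, (μ + c * u) ∈ {y : ℝ | p * f₁ y > (1 - p) * f₀ y} ↔
      u ∈ Set.Ioi (-z₁p) ∪ Set.Iio z₁m := by
    intro u
    have e1 : p * f₁ (μ + c * u) = (p / (w * D)) * Real.exp (-u ^ 2 / 2) := by
      rw [hf1u']; ring
    have e2 : (1 - p) * f₀ (μ + c * u) = (p / (w * D)) *
        Real.exp (η + Real.log (1 + t) / 2 + -(k * r + w * u) ^ 2 / 2) := by
      rw [hf0u, Real.exp_add, Real.exp_add, ← hwexp, hpη]; field_simp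
    rw [Set.mem_setOf_eq, e1, e2, gt_iff_lt, mul_lt_mul_iff_right₀ (by positivity), Real.exp_lt_exp]
    have e3 : (k * r + w * u) ^ 2 - u ^ 2 = (r * u + k * w) ^ 2 - k ^ 2 := by
      have : w ^ 2 = 1 + r ^ 2 := by rw [hw2, hr2]
      linear_combination (u ^ 2 - k ^ 2) * this
    have e4 : (η + Real.log (1 + t) / 2 + -(k * r + w * u) ^ 2 / 2 < -u ^ 2 / 2) ↔
        (k * q) ^ 2 < (r * u + k * w) ^ 2 := by
      have e7 : (k * q) ^ 2 = k ^ 2 * (q ^ 2 - 1) + k ^ 2 := by ring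
      rw [e7, ← hL]
      constructor <;> intro h <;> linarith
    rw [e4, sq_lt_sq, abs_of_pos (mul_pos hk0 hq0), lt_abs]
    simp only [Set.mem_union, Set.mem_Ioi, Set.mem_Iio]
    have e5 : -z₁p = (k * q - k * w) / r := by rw [hz₁p]; ring
    have e6 : z₁m = (-(k * q) - k * w) / r := by rw [hz₁m]; ring
    rw [e5, e6, div_lt_iff₀ hr0, lt_div_iff₀ hr0]
    constructor <;> rintro (h | h)
    · left; linarith
    · right; linarith
    · left; linarith
    · right; linarith
  have hmeas : MeasurableSet {y : ℝ | p * f₁ y > (1 - p) * f₀ y} := by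
    apply measurableSet_lt
    · rw [hf₀]; unfold gaussPdf; fun_prop
    · rw [hf₁]; unfold gaussPdf; fun_prop
  rw [← integral_indicator hmeas]
  set G := Set.indicator {y : ℝ | p * f₁ y > (1 - p) * f₀ y} (fun y => f₁ y) with hG
  have hsub : ∫ y, G y = c * ∫ u, G (μ + c * u) := by
    have h := Measure.integral_comp_mul_left (fun y => G (μ + y)) c
    rw [integral_add_left_eq_self, abs_of_pos (inv_pos.2 hc0), smul_eq_mul] at h
    rw [h]; field_simp
  have hGu : ∀ u, G (μ + c * u) =
      c⁻¹ * (Set.Ioi (-z₁p) ∪ Set.Iio z₁m).indicator (fun u => gaussPdf 0 1 u) u := by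
    intro u
    by_cases h : u ∈ Set.Ioi (-z₁p) ∪ Set.Iio z₁m
    · rw [Set.indicator_of_mem h, hG, Set.indicator_of_mem ((hset u).2 h), hf1u]
    · rw [Set.indicator_of_notMem h, hG, Set.indicator_of_notMem (fun h' => h ((hset u).1 h')),
        mul_zero]
  have hlt : z₁m < -z₁p := by
    have : 0 < k / r * q := by positivity
    rw [hz₁m, hz₁p]; linarith
  have hdis : Disjoint (Set.Ioi (-z₁p)) (Set.Iio z₁m) := by
    rw [Set.disjoint_left]
    intro x hx hx'
    simp only [Set.mem_Ioi, Set.mem_Iio] at hx hx'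
    linarith
  rw [hsub]
  simp_rw [hGu]
  rw [integral_const_mul, ← mul_assoc, mul_inv_cancel₀ hc0.ne', one_mul,
    integral_indicator (measurableSet_Ioi.union measurableSet_Iio),
    setIntegral_union hdis measurableSet_Iio gaussPdf_integrable_aux.integrableOn
      gaussPdf_integrable_aux.integrableOn, gaussPdf_Ioi_aux, ← integral_Iic_eq_integral_Iio]
  rfl
end
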